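/- Let M be a finitely generated A-module with dim M = d ≥ 1, 𝓜 = {M_n}_{n≥0} a good I-filtration of M, D(I,M) an extended degree, and q an ideal with I ⊆ q and M_{n+1} ⊆ q M_n for all n ≥ 0. Then for the Hilbert coefficients of the fiber cone F_q(𝓜): (i) e_0(F_q(𝓜)) ≤ 2 D(I,M)(D(I,M) + r(𝓜)); (ii) |e_i(F_q(𝓜))| ≤ 2 (D(I,M) + r(𝓜) + 2)^{3(i+1)! − i} for 1 ≤ i ≤ d−1. -/

import Mathlib

/-!
Formalization of results from:
L.X. Dung, L.T. Hoa, "Castelnuovo-Mumford regularity of associated graded modules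
and fiber cones of filtered modules".

Setting: `(A, 𝔪)` is a Noetherian local ring with infinite residue field, `I` an
`𝔪`-primary ideal, `M` a finitely generated `A`-module, and `𝓜 = {M_n}` a good
`I`-filtration of `M`.

Notions that are not available in Mathlib (the Castelnuovo–Mumford regularity of the
associated graded module `G(𝓜) = ⊕ M_n/M_{n+1}` over `G_I(A)`, defined via graded local
cohomology, and similar graded invariants) are taken as explicit parameters of the
theorems, documented where they occur.  Everything else is defined concretely below.
-/

open Filter IsLocalRing

universe u

section Preliminaries

variable {A : Type u} [CommRing A] {M : Type u} [AddCommGroup M] [Module A M]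

/-- The length `ℓ(M)` of a module, as the Krull dimension of its lattice of submodules. -/
noncomputable def moduleLength (A : Type u) (M : Type u) [CommRing A] [AddCommGroup M]
    [Module A M] : WithBot ℕ∞ :=
  Order.krullDim (Submodule A M)

/-- The zeroth local cohomology `H⁰_J(M)`, i.e. the `J`-torsion submodule
`{m ∈ M ∣ J^k • m = 0 for some k}`. -/
noncomputable def lcZero (J : Ideal A) (M : Type u) [AddCommGroup M] [Module A M] :
    Submodule A M :=
  ⨆ k : ℕ, Submodule.torsionBySet A M ((J ^ k : Ideal A) : Set A)

/-- `I` is an `𝔪`-primary (proper) ideal of the local ring `A`. -/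
def IsMaxPrimary [IsLocalRing A] (I : Ideal A) : Prop :=
  I ≠ ⊤ ∧ I.radical = maximalIdeal A

/-- A good `I`-filtration `𝓜 : M = M₀ ⊇ M₁ ⊇ ⋯`: an `I`-filtration
(`I • M_n ⊆ M_{n+1}`, packaged in Mathlib's `Ideal.Filtration`) which starts at `M`
and satisfies `I • M_n = M_{n+1}` for all large `n` (stability). -/
def Ideal.Filtration.IsGood {I : Ideal A} (F : I.Filtration M) : Prop :=
  F.N 0 = ⊤ ∧ F.Stable

/-- `r(𝓜) = min {t ≥ 0 ∣ M_{n+1} = I•M_n for all n ≥ t}`, the maximal generating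
degree of `G(𝓜)` over `G_I(A)`. -/
noncomputable def Ideal.Filtration.genDeg {I : Ideal A} (F : I.Filtration M) : ℕ :=
  sInf {t | ∀ n, t ≤ n → F.N (n + 1) = I • F.N n}

/-- The initial form `x*` of `x ∈ I` is a (linear) filter-regular element on `G(𝓜)`,
expressed elementwise: `(M_{n+2} :_M x) ∩ M_n = M_{n+1}` for all `n ≫ 0`. -/
def Ideal.Filtration.FilterRegular {I : Ideal A} (F : I.Filtration M) (x : A) : Prop :=
  ∀ᶠ n : ℕ in atTop,
    (F.N (n + 2)).comap (LinearMap.lsmul A M x) ⊓ F.N n = F.N (n + 1)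

/-- The quotient filtration `𝓜/p = {(M_n + p)/p}` on `M/p`. -/
def Ideal.Filtration.quot {I : Ideal A} (F : I.Filtration M) (p : Submodule A M) :
    I.Filtration (M ⧸ p) where
  N n := (F.N n).map p.mkQ
  mono n := Submodule.map_mono (F.mono n)
  smul_le n := by
    rw [← Submodule.map_smul'']
    exact Submodule.map_mono (F.smul_le n)

/-- Vanishing of the degree-`n` graded piece of `H⁰_{G₊}(G(𝓜))`, expressed elementwise:
every `m ∈ M_n` with `I^k • m ⊆ M_{n+k+1}` for some `k` lies in `M_{n+1}`. -/
def Ideal.Filtration.H0GradedVanish {I : Ideal A} (F : I.Filtration M) (n : ℕ) : Prop :=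
  ∀ m ∈ F.N n, (∃ k : ℕ, ∀ c ∈ I ^ k, c • m ∈ F.N (n + k + 1)) → m ∈ F.N (n + 1)

/-- An extended degree `D(I,·)` on finitely generated `A`-modules with respect to an
`𝔪`-primary ideal `I`:
(i) `D(I,N) = D(I,N/H⁰_𝔪(N)) + ℓ(H⁰_𝔪(N))`;
(ii) `D(I,N) ≥ D(I,N/xN)` for a generic element `x ∈ I ∖ 𝔪I` on `N` (genericity is
     rendered as the existence of such an `x` which is moreover filter-regular);
(iii) `D(I,N) = e(I,N)`, the multiplicity, if `N` is Cohen–Macaulay (Cohen–Macaulayness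
      is rendered via the existence of a regular sequence of parameters, and the
      multiplicity via the leading coefficient of the Hilbert–Samuel polynomial). -/
structure IsExtendedDegree [IsLocalRing A] (I : Ideal A)
    (D : (N : Type u) → [AddCommGroup N] → [Module A N] → ℕ) : Prop where
  h0_add : ∀ (N : Type u) [AddCommGroup N] [Module A N] [Module.Finite A N],
    (D N : WithBot ℕ∞) =
      (D (N ⧸ lcZero (maximalIdeal A) N) : WithBot ℕ∞) +
        moduleLength A (lcZero (maximalIdeal A) N)
  generic : ∀ (N : Type u) [AddCommGroup N] [Module A N] [Module.Finite A N],
    Nontrivial N →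
    ∃ x ∈ I, x ∉ maximalIdeal A * I ∧
      (Ideal.stableFiltration I (⊤ : Submodule A N)).FilterRegular x ∧
      D (N ⧸ (Ideal.span {x} • (⊤ : Submodule A N))) ≤ D N
  cohenMacaulay : ∀ (N : Type u) [AddCommGroup N] [Module A N] [Module.Finite A N]
    (d : ℕ) (c : ℕ → ℤ) (H : ℕ → ℕ),
    (∃ rs : List A, (∀ y ∈ rs, y ∈ maximalIdeal A) ∧ RingTheory.Sequence.IsRegular N rs ∧
        moduleLength A (N ⧸ (Ideal.ofList rs • (⊤ : Submodule A N))) ≠ ⊤) →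
    ringKrullDim (A ⧸ Module.annihilator A N) = (d : WithBot ℕ∞) →
    (∀ n : ℕ, moduleLength A (N ⧸ ((I ^ (n + 1)) • (⊤ : Submodule A N))) = (H n : WithBot ℕ∞)) →
    (∀ᶠ n : ℕ in atTop,
      (H n : ℤ) = ∑ i ∈ Finset.range (d + 1),
        (-1) ^ i * c i * ((n + d - i).choose (d - i) : ℤ)) →
    (D N : ℤ) = c 0

end Preliminaries

namespace FC
section Len
variable {A : Type u} [CommRing A] {N : Type u} [AddCommGroup N] [Module A N]
variable {N' : Type u} [AddCommGroup N'] [Module A N'] {N'' : Type u} [AddCommGroup N''] [Module A N'']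

/-- finite colength -/
def FinCl (X : Submodule A N) : Prop := Module.length A (N ⧸ X) ≠ ⊤

/-- colength as an integer -/
noncomputable def cl (X : Submodule A N) : ℤ := ((Module.length A (N ⧸ X)).toNat : ℤ)

/-- relative length of `(X + Z) / X` -/
noncomputable def rl (X Z : Submodule A N) : ℕ∞ := Module.length A (Z.map X.mkQ)

theorem length_map_congr (Z : Submodule A N) (g : N →ₗ[A] N') (g' : N →ₗ[A] N'')
    (h : ∀ z ∈ Z, g z = 0 ↔ g' z = 0) :
    Module.length A (Z.map g) = Module.length A (Z.map g') := by
  have e : ∀ {K : Type u} [AddCommGroup K] [Module A K] (k : N →ₗ[A] K),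
      Module.length A (Z.map k) = Module.length A (Z ⧸ LinearMap.ker (k.domRestrict Z)) := by
    intro K _ _ k
    have h1 : LinearMap.range (k.domRestrict Z) = Z.map k := by
      ext x; simp
    rw [← h1]
    exact (LinearEquiv.length_eq (k.domRestrict Z).quotKerEquivRange).symm
  rw [e g, e g']
  have : LinearMap.ker (g.domRestrict Z) = LinearMap.ker (g'.domRestrict Z) := by
    ext ⟨z, hz⟩; simpa using h z hz
  rw [this]

theorem length_eq_rl_add (X Z : Submodule A N) :
    Module.length A (N ⧸ X) = rl X Z + Module.length A (N ⧸ (X ⊔ Z)) := by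
  have := Module.length_eq_add_of_exact (R := A) (Submodule.subtype (Z.map X.mkQ))
    (Submodule.mkQ (Z.map X.mkQ)) (Submodule.injective_subtype _) (Submodule.mkQ_surjective _)
    (by rw [LinearMap.exact_iff]; simp)
  rw [this, rl]
  congr 1
  apply LinearEquiv.length_eq
  have e1 : X ≤ X ⊔ Z := le_sup_left
  have e2 : (X ⊔ Z).map X.mkQ = Z.map X.mkQ := by
    rw [Submodule.map_sup]; simp
  exact (Submodule.quotEquivOfEq _ _ e2.symm).trans (Submodule.quotientQuotientEquivQuotient X (X ⊔ Z) e1)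

theorem rl_map (X Z : Submodule A N) (f : N →ₗ[A] N) : rl X (Z.map f) = rl (X.comap f) Z := by
  rw [rl, rl, ← Submodule.map_comp]
  apply length_map_congr
  intro z _
  simp

theorem rl_congr (X X' Z : Submodule A N) (h : X ⊓ Z = X' ⊓ Z) : rl X Z = rl X' Z := by
  apply length_map_congr
  intro z hz
  simp only [Submodule.mkQ_apply, Submodule.Quotient.mk_eq_zero]
  have := SetLike.ext_iff.mp h z
  simpa [hz] using this

theorem rl_anti {X X' : Submodule A N} (Z : Submodule A N) (h : X ≤ X') : rl X' Z ≤ rl X Z := by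
  have : Z.map X'.mkQ = (Z.map X.mkQ).map (Submodule.factor h) := by
    rw [← Submodule.map_comp]; congr 1
  rw [rl, rl, this]
  exact Module.length_le_of_surjective ((Submodule.factor h).submoduleMap _) (LinearMap.submoduleMap_surjective _ _)

theorem FinCl.mono {X Y : Submodule A N} (hX : FinCl X) (h : X ≤ Y) : FinCl Y := by
  have := length_eq_rl_add X Y
  rw [sup_eq_right.mpr h] at this
  intro hY
  rw [hY] at this
  exact hX (by simp [this])

theorem FinCl.rl {X : Submodule A N} (hX : FinCl X) (Z : Submodule A N) : rl X Z ≠ ⊤ := by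
  have := length_eq_rl_add X Z
  intro hY
  rw [hY] at this
  exact hX (by simp [this])

theorem cl_eq_rl_add {X : Submodule A N} (hX : FinCl X) (Z : Submodule A N) :
    cl X = ((rl X Z).toNat : ℤ) + cl (X ⊔ Z) := by
  rw [cl, length_eq_rl_add X Z, ENat.toNat_add (hX.rl Z) (hX.mono le_sup_left)]
  simp [cl]

theorem cl_anti {X Y : Submodule A N} (hX : FinCl X) (h : X ≤ Y) : cl Y ≤ cl X := by
  have := cl_eq_rl_add hX Y
  rw [sup_eq_right.mpr h] at this
  omega

theorem cl_nonneg (X : Submodule A N) : 0 ≤ cl X := by simp [cl]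

@[simp] theorem cl_top : cl (⊤ : Submodule A N) = 0 := by
  simp [cl, Module.length_eq_zero]

theorem FinCl.inf {X Y : Submodule A N} (hX : FinCl X) (hY : FinCl Y) : FinCl (X ⊓ Y) := by
  have h := length_eq_rl_add (X ⊓ Y) Y
  rw [rl_congr (X ⊓ Y) X Y (by rw [inf_assoc, inf_idem]), sup_eq_right.mpr inf_le_right] at h
  intro h'
  rw [h', eq_comm, ENat.add_eq_top] at h
  exact h.elim (hX.rl Y) hY

theorem fin_comap {X Y : Submodule A N} (f : N →ₗ[A] N) (hX : FinCl X) (hY : FinCl Y) :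
    FinCl (X.comap f ⊓ Y) := by
  have h := length_eq_rl_add (X.comap f ⊓ Y) Y
  rw [rl_congr (X.comap f ⊓ Y) (X.comap f) Y (by rw [inf_assoc, inf_idem]), sup_eq_right.mpr inf_le_right,
    ← rl_map] at h
  intro h'
  rw [h', eq_comm, ENat.add_eq_top] at h
  exact h.elim (hX.rl _) hY

theorem cl_comap {X Y : Submodule A N} (f : N →ₗ[A] N) (hX : FinCl X) (hY : FinCl Y) :
    cl X - cl (X ⊔ Y.map f) = cl (X.comap f ⊓ Y) - cl Y := by
  have h := cl_eq_rl_add (fin_comap f hX hY) Y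
  rw [rl_congr (X.comap f ⊓ Y) (X.comap f) Y (by rw [inf_assoc, inf_idem]), sup_eq_right.mpr inf_le_right,
    ← rl_map] at h
  have h2 := cl_eq_rl_add hX (Y.map f)
  omega

theorem cl_inf_sup {X Y : Submodule A N} (hX : FinCl X) (hY : FinCl Y) :
    cl X - cl (X ⊔ Y) = cl (X ⊓ Y) - cl Y := by
  simpa using cl_comap LinearMap.id hX hY

theorem eq_of_cl {X Y : Submodule A N} (hX : FinCl X) (h : X ≤ Y) (hc : cl X = cl Y) : X = Y := by
  have h1 := cl_eq_rl_add hX Y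
  rw [sup_eq_right.mpr h, hc] at h1
  have h2 : rl X Y = 0 := by
    have := (ENat.toNat_eq_zero (n := rl X Y)).mp (by omega)
    exact this.resolve_right (hX.rl Y)
  rw [rl, Module.length_eq_zero_iff, Submodule.subsingleton_iff_eq_bot, ← le_bot_iff,
    Submodule.map_le_iff_le_comap] at h2
  apply le_antisymm h
  simpa using h2

theorem length_map_surj (π : N →ₗ[A] N') (hπ : Function.Surjective π) (X : Submodule A N) :
    Module.length A (N' ⧸ X.map π) = Module.length A (N ⧸ (X ⊔ LinearMap.ker π)) := by
  apply LinearEquiv.length_eq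
  have h1 : (LinearMap.ker ((X.map π).mkQ ∘ₗ π)) = X ⊔ LinearMap.ker π := by
    rw [LinearMap.ker_comp, Submodule.ker_mkQ, Submodule.comap_map_eq]
  rw [← h1]
  refine (LinearMap.quotKerEquivOfSurjective ((X.map π).mkQ ∘ₗ π) ?_).symm
  rw [LinearMap.coe_comp]
  exact (Submodule.mkQ_surjective _).comp hπ

theorem cl_map (π : N →ₗ[A] N') (hπ : Function.Surjective π) (X : Submodule A N) :
    cl (X.map π) = cl (X ⊔ LinearMap.ker π) := by
  rw [cl, cl, length_map_surj π hπ]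

theorem FinCl.map {X : Submodule A N} (hX : FinCl X) (π : N →ₗ[A] N') (hπ : Function.Surjective π) :
    FinCl (X.map π) := by
  rw [FinCl, length_map_surj π hπ]
  exact hX.mono le_sup_left

theorem moduleLength_eq : moduleLength A N = ((Module.length A N : ℕ∞) : WithBot ℕ∞) := by
  rw [Module.coe_length]; rfl

end Len
end FC

namespace FC
section Step
variable {A : Type u} [CommRing A] {N : Type u} [AddCommGroup N] [Module A N]
variable {N' : Type u} [AddCommGroup N'] [Module A N']

/-- The elementary regularity predicate. -/
structure Reg (I J : Ideal A) (F : ℕ → Submodule A N) (s : ℕ) : Prop where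
  hJ : J ≤ I
  r1 : ∀ n, s ≤ n → ∀ (u : N) (j : ℕ), (∀ a ∈ I ^ j, a • u ∈ F (n + j)) → u ∈ F n
  r3 : ∀ n, s ≤ n → F (n + 1) ≤ J • F n
  r4 : ∀ n, s ≤ n → ∀ (Q : Type u) [AddCommGroup Q] [Module A Q] (π : Q →ₗ[A] N)
    (X1 X0 : Submodule A Q), X1.map π = F (n + 1) → X0.map π = F n → J • X0 ≤ X1 →
    LinearMap.ker π ⊓ J • X1 ≤ J • (LinearMap.ker π ⊓ X1)

/-- Ratliff–Rush type closure of a filtration. -/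
def RR {I : Ideal A} (F : I.Filtration N) (n : ℕ) : Submodule A N where
  carrier := {u | ∃ j, ∀ k, j ≤ k → ∀ a ∈ I ^ k, a • u ∈ F.N (n + k)}
  zero_mem' := ⟨0, fun k _ a _ => by simp⟩
  add_mem' := by
    rintro u v ⟨j, hj⟩ ⟨j', hj'⟩
    refine ⟨max j j', fun k hk a ha => ?_⟩
    rw [smul_add]
    exact add_mem (hj k (le_trans (le_max_left _ _) hk) a ha) (hj' k (le_trans (le_max_right _ _) hk) a ha)
  smul_mem' := by
    rintro b u ⟨j, hj⟩
    refine ⟨j, fun k hk a ha => ?_⟩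
    rw [smul_comm]
    exact Submodule.smul_mem _ _ (hj k hk a ha)

theorem mem_RR {I : Ideal A} {F : I.Filtration N} {n : ℕ} {u : N} :
    u ∈ RR F n ↔ ∃ j, ∀ k, j ≤ k → ∀ a ∈ I ^ k, a • u ∈ F.N (n + k) := Iff.rfl

theorem pow_smul_mem {I : Ideal A} (F : I.Filtration N) {n k : ℕ} {a : A} {u : N} (ha : a ∈ I ^ k)
    (hu : u ∈ F.N n) : a • u ∈ F.N (n + k) := by
  have := F.pow_smul_le k n (Submodule.smul_mem_smul ha hu)
  rwa [add_comm] at this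

theorem mem_RR_of {I : Ideal A} {F : I.Filtration N} {n : ℕ} {u : N} (j : ℕ)
    (h : ∀ a ∈ I ^ j, a • u ∈ F.N (n + j)) : u ∈ RR F n := by
  refine ⟨j, fun k hk a ha => ?_⟩
  obtain ⟨i, rfl⟩ := Nat.exists_eq_add_of_le hk
  rw [pow_add] at ha
  refine Submodule.mul_induction_on ha ?_ ?_
  · intro m hm b hb
    rw [mul_comm, mul_smul, ← add_assoc]
    exact pow_smul_mem F hb (h m hm)
  · intro x y hx hy
    rw [add_smul]
    exact add_mem hx hy

theorem le_RR {I : Ideal A} (F : I.Filtration N) (n : ℕ) : F.N n ≤ RR F n :=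
  fun _ hu => mem_RR_of 0 fun a _ => by simpa using Submodule.smul_mem _ a hu

theorem smul_RR_le {I : Ideal A} (F : I.Filtration N) (n : ℕ) : I • RR F n ≤ RR F (n + 1) := by
  rw [Submodule.smul_le]
  rintro a ha u ⟨j, hj⟩
  refine ⟨j, fun k hk b hb => ?_⟩
  rw [← mul_smul]
  have := hj (k + 1) (by omega) (b * a) (by rw [pow_succ]; exact Ideal.mul_mem_mul hb ha)
  convert this using 2
  omega

theorem RR_of_smul {I : Ideal A} (F : I.Filtration N) {y : A} {c : ℕ}
    (hsup : ∀ n, c ≤ n → ∀ u, y • u ∈ F.N (n + 1) → u ∈ F.N n) (n : ℕ) (u : N)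
    (h : y • u ∈ RR F (n + 1)) : u ∈ RR F n := by
  obtain ⟨j, hj⟩ := h
  refine ⟨max j c, fun k hk a ha => hsup _ (by omega) _ ?_⟩
  rw [smul_comm]
  convert hj k (by omega) a ha using 2
  omega

theorem RR_eq_of_le {I : Ideal A} (F : I.Filtration N) {y : A} (hy : y ∈ I) {c : ℕ}
    (hsup : ∀ n, c ≤ n → ∀ u, y • u ∈ F.N (n + 1) → u ∈ F.N n) (n : ℕ) (hn : c ≤ n) :
    RR F n = F.N n := by
  apply le_antisymm _ (le_RR F n)
  rintro u ⟨j, hj⟩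
  have h1 := hj j le_rfl (y ^ j) (Ideal.pow_mem_pow hy j)
  clear hj
  induction j with
  | zero => simpa using h1
  | succ j ih =>
    apply ih
    apply hsup _ (by omega)
    rw [← mul_smul, ← pow_succ']
    exact h1

theorem le_smul_sup {J : Ideal A} (π : N →ₗ[A] N') {X Y : Submodule A N}
    (h : X.map π ≤ J • Y.map π) (hle : J • Y ≤ X) : X ≤ J • Y ⊔ (LinearMap.ker π ⊓ X) := by
  rw [← Submodule.map_smul'', Submodule.map_le_iff_le_comap, Submodule.comap_map_eq] at h
  rw [← sup_inf_assoc_of_le _ hle]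
  exact le_inf h le_rfl

theorem downward (P : ℕ → Prop) (s c : ℕ) (h : ∀ n, c ≤ n → P n)
    (hs : ∀ n, s ≤ n → (∀ m, n < m → P m) → P n) : ∀ n, s ≤ n → P n := by
  have key : ∀ k n, s ≤ n → c ≤ n + k → P n := by
    intro k
    induction k with
    | zero => intro n _ h2; exact h n h2
    | succ k ih =>
      intro n h1 h2
      exact hs n h1 fun m hm => ih m (by omega) (by omega)
  exact fun n hn => key c n hn (by omega)

theorem one_step {I : Ideal A} (F : I.Filtration N) (hF0 : F.N 0 = ⊤) (hfin : ∀ n, FinCl (F.N n))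
    {y : A} (hy : y ∈ I) (hreg : ∀ u : N, y • u = 0 → u = 0)
    {c : ℕ} (hsup : ∀ n, c ≤ n → ∀ u, y • u ∈ F.N (n + 1) → u ∈ F.N n)
    {s' : ℕ} (hgen : ∀ n, s' + 1 ≤ n → F.N (n + 1) ≤ I • F.N n)
    (π : N →ₗ[A] N') (hπ : Function.Surjective π) (hyU : ∀ u, π (y • u) = 0)
    (hU : ∀ n, c ≤ n → LinearMap.ker π ⊓ F.N n ≤ (⊤ : Submodule A N).map (LinearMap.lsmul A N y))
    {l : ℕ} (hl : rl ((⊤ : Submodule A N).map (LinearMap.lsmul A N y)) (LinearMap.ker π) = l)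
    (F' : ℕ → Submodule A N') (hF' : ∀ n, F' n = (F.N n).map π)
    {J' : Ideal A} (hR : Reg I J' F' s')
    (p : ℕ → ℤ) (hp : ∀ n, s' ≤ n + 1 → p n = l + cl (F' (n + 1)))
    {B : ℕ} (hB : ∀ j, j ≤ s' → |p j| ≤ B) :
    Reg I (Ideal.span {y} ⊔ J') F.N (s' + B) ∧
    ∃ e : ℤ, 2 * |e| ≤ 4 * s' * B + B * (B + 1) ∧
      ∀ n, s' + B ≤ n → cl (F.N n) = e + ∑ j ∈ Finset.range n, p j := by
  classical
  set Y := LinearMap.lsmul A N y with hY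
  set U := LinearMap.ker π with hUdef
  have Yap : ∀ u, Y u = y • u := fun u => by simp [hY]
  have hmapY : ∀ X : Submodule A N, X.map Y ≤ U := by
    intro X
    rw [Submodule.map_le_iff_le_comap]
    intro u _
    simpa [hUdef, Yap] using hyU u
  have hYF : ∀ n, (F.N n).map Y ≤ F.N (n + 1) := by
    intro n
    rw [Submodule.map_le_iff_le_comap]
    intro u hu
    simp only [Submodule.mem_comap, Yap]
    exact F.smul_le n (Submodule.smul_mem_smul hy hu)
  have hanti : ∀ {m n}, m ≤ n → F.N n ≤ F.N m := fun h => F.antitone h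
  set Xs : ℕ → Submodule A N := fun n => RR F (n + 1) ⊓ F.N n with hXs
  have hFXs : ∀ n, F.N (n + 1) ≤ Xs n := fun n => le_inf (le_RR F _) (F.mono n)
  have hfX : ∀ n, FinCl (Xs n) := fun n => (hfin (n + 1)).mono (hFXs n)
  set g : ℕ → ℤ := fun n => cl (Xs n) - cl (F.N n) with hg
  have hg0 : ∀ n, 0 ≤ g n := fun n => by
    have := cl_anti (hfX n) (inf_le_right : Xs n ≤ F.N n)
    simp only [hg]; omega
  set H' : ℕ → ℤ := fun n => cl (F' n) with hH'
  have hH'eq : ∀ n, H' n = cl (F.N n ⊔ U) := fun n => by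
    simp only [hH', hF']; rw [cl_map π hπ]
  have hH'mono : ∀ {m n}, m ≤ n → H' m ≤ H' n := by
    intro m n h
    rw [hH'eq, hH'eq]
    exact cl_anti ((hfin n).mono le_sup_left) (sup_le_sup_right (hanti h) _)
  set Z : ℕ → Submodule A N := fun n => Xs (n + 1) ⊔ (F.N n).map Y with hZ
  -- index shift: Z n is `Z_{n+1}` of the text
  have hfZ : ∀ n, FinCl (Z n) := fun n => (hfX (n + 1)).mono le_sup_left
  have e1 : ∀ n, cl (Xs (n + 1)) - cl (Z n) = g n := by
    intro n
    have h := cl_comap Y (hfX (n + 1)) (hfin n)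
    have h2 : (Xs (n + 1)).comap Y ⊓ F.N n = Xs n := by
      ext u
      simp only [hXs, Submodule.mem_inf, Submodule.mem_comap, Yap]
      constructor
      · rintro ⟨⟨h1, -⟩, h2⟩
        exact ⟨RR_of_smul F hsup _ u h1, h2⟩
      · rintro ⟨h1, h2⟩
        exact ⟨⟨smul_RR_le F _ (Submodule.smul_mem_smul hy h1),
          F.smul_le _ (Submodule.smul_mem_smul hy h2)⟩, h2⟩
    rw [h2] at h
    exact h
  set k : ℕ → ℤ := fun n => cl (Z n) - cl (Z n ⊔ (F.N (n + 1) ⊓ U)) with hk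
  have hk0 : ∀ n, 0 ≤ k n := fun n => by
    have := cl_anti (hfZ n) (le_sup_left : Z n ≤ Z n ⊔ (F.N (n + 1) ⊓ U))
    simp only [hk]; omega
  have hXU : ∀ n, s' ≤ n + 1 → Xs n ⊔ U = F.N (n + 1) ⊔ U := by
    intro n hn
    apply le_antisymm _ (sup_le_sup_right (hFXs n) _)
    apply sup_le _ le_sup_right
    rintro u ⟨⟨j, hj⟩, -⟩
    have : π u ∈ F' (n + 1) := by
      apply hR.r1 _ hn _ j
      intro a ha
      rw [hF', ← map_smul]
      exact Submodule.mem_map_of_mem (hj j le_rfl a ha)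
    rw [hF'] at this
    rw [hUdef, ← Submodule.comap_map_eq]
    exact this
  have e2 : ∀ n, s' ≤ n + 2 → cl (Z n ⊔ (F.N (n + 1) ⊓ U)) - cl (F.N (n + 1)) = H' (n + 2) - H' (n + 1) := by
    intro n hn
    have h1 : Z n ⊔ (F.N (n + 1) ⊓ U) = (Xs (n + 1) ⊔ U) ⊓ F.N (n + 1) := by
      rw [hZ]
      simp only
      rw [sup_assoc, sup_eq_right.mpr (le_inf (hYF n) (hmapY _)), inf_comm (F.N (n + 1)) U,
        ← sup_inf_assoc_of_le U (inf_le_right : Xs (n + 1) ≤ F.N (n + 1))]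
    have hf1 : FinCl (Xs (n + 1) ⊔ U) := (hfX (n + 1)).mono le_sup_left
    rw [h1, ← cl_inf_sup hf1 (hfin (n + 1)), hXU _ hn, hH'eq, hH'eq]
    congr 2
    rw [sup_right_comm, sup_eq_right.mpr (F.mono (n + 1))]
  set q : ℕ → ℤ := fun n => p n - g n with hq
  have e3 : ∀ n, s' ≤ n + 1 → q n - q (n + 1) = k n := by
    intro n hn
    have h1 := e1 n
    have h2 := e2 n (by omega)
    have h3 := hp n hn
    have h4 := hp (n + 1) (by omega)
    simp only [hq, hk, h3, h4]
    simp only [hH'] at h2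
    have h5 : g (n + 1) = cl (Xs (n + 1)) - cl (F.N (n + 1)) := rfl
    rw [show n + 1 + 1 = n + 2 from rfl]
    linarith
  -- bounds for the Hilbert function
  have htop : FinCl (⊤ : Submodule A N) := hF0 ▸ hfin 0
  have hle : ∀ n, cl (F.N (n + 1)) - cl (F.N n) ≤ l + H' (n + 1) ∧
      (c ≤ n → cl (F.N (n + 1)) - cl (F.N n) = l + H' (n + 1)) := by
    intro n
    have h1 := cl_comap Y (hfin (n + 1)) htop
    rw [inf_top_eq, cl_top] at h1
    have h2 : F.N n ≤ (F.N (n + 1)).comap Y := by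
      rw [← Submodule.map_le_iff_le_comap]; exact hYF n
    have h2' := cl_anti (hfin n) h2
    have hf : FinCl (F.N (n + 1) ⊔ (⊤ : Submodule A N).map Y) := (hfin (n + 1)).mono le_sup_left
    have h3 := cl_eq_rl_add hf U
    rw [sup_assoc, sup_eq_right.mpr (hmapY ⊤)] at h3
    constructor
    · have h4 : rl (F.N (n + 1) ⊔ (⊤ : Submodule A N).map Y) U ≤ l := by
        rw [← hl]; exact rl_anti _ le_sup_right
      have h5 : (rl (F.N (n + 1) ⊔ (⊤ : Submodule A N).map Y) U).toNat ≤ l := by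
        simpa using ENat.toNat_le_toNat h4 (by simp)
      rw [hH'eq]
      have : ((rl (F.N (n + 1) ⊔ (⊤ : Submodule A N).map Y) U).toNat : ℤ) ≤ l := by exact_mod_cast h5
      linarith
    · intro hn
      have h4 : (F.N (n + 1)).comap Y = F.N n := by
        apply le_antisymm _ h2
        intro u hu
        exact hsup n hn u (by simpa [Yap] using hu)
      rw [h4] at h1
      have h5 : rl (F.N (n + 1) ⊔ (⊤ : Submodule A N).map Y) U = l := by
        rw [← hl]
        apply rl_congr
        rw [sup_comm, sup_inf_assoc_of_le _ (hmapY ⊤), inf_comm (F.N (n + 1)), inf_eq_left.mpr (hmapY ⊤)]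
        exact sup_eq_left.mpr (hU _ (by omega))
      rw [h5] at h3
      simp only [ENat.toNat_natCast] at h3
      rw [hH'eq]
      linarith
  have hXsC : ∀ n, c ≤ n → Xs n = F.N (n + 1) := by
    intro n hn
    simp only [hXs]
    rw [RR_eq_of_le F hy hsup _ (by omega)]
    exact inf_eq_left.mpr (F.mono n)
  have hqC : ∀ n, c ≤ n → s' ≤ n + 1 → q n = 0 := by
    intro n hn hn'
    simp only [hq, hg, hXsC n hn]
    rw [(hle n).2 hn, hp n hn']
    simp [hH']
  have hqnn : ∀ n, s' ≤ n → 0 ≤ q n := by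
    refine downward (fun n => 0 ≤ q n) _ (c + s') ?_ ?_
    · intro n hn
      rw [hqC n (by omega) (by omega)]
    · intro n hn ih
      have := ih (n + 1) (by omega)
      have h2 := e3 n (by omega)
      have h3 := hk0 n
      linarith
  -- key inclusion
  have hIU : ∀ n, s' ≤ n → F.N (n + 2) ⊓ U ≤ I • (F.N (n + 1) ⊓ U) := by
    intro n hn
    have hJF : J' • F.N n ≤ F.N (n + 1) := (Submodule.smul_mono_left hR.hJ).trans (F.smul_le n)
    have h1 : F.N (n + 1) ≤ J' • F.N n ⊔ (U ⊓ F.N (n + 1)) := by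
      apply le_smul_sup π _ hJF
      rw [← hF', ← hF']
      exact hR.r3 n hn
    have h2 : F.N (n + 2) ≤ J' • F.N (n + 1) ⊔ I • (U ⊓ F.N (n + 1)) := by
      refine (hgen (n + 1) (by omega)).trans ?_
      refine (Submodule.smul_mono le_rfl h1).trans ?_
      rw [Submodule.smul_sup]
      apply sup_le_sup_right
      rw [← mul_smul, mul_comm, mul_smul]
      exact Submodule.smul_mono le_rfl (F.smul_le n)
    have h3 := hR.r4 n hn N π (F.N (n + 1)) (F.N n) (hF' _).symm (hF' _).symm hJF
    rintro w ⟨hw, hwU⟩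
    obtain ⟨a, ha, b, hb, rfl⟩ := Submodule.mem_sup.mp (h2 hw)
    have hbU : b ∈ U := (Submodule.smul_le_right.trans inf_le_left) hb
    have haU : a ∈ U := by
      have := sub_mem hwU hbU
      simpa using this
    rw [inf_comm]
    exact add_mem (Submodule.smul_mono_left hR.hJ (h3 ⟨haU, ha⟩)) hb
  have hkstep : ∀ n, s' ≤ n → k n = 0 → k (n + 1) = 0 := by
    intro n hn h0
    have h1 : Z n = Z n ⊔ (F.N (n + 1) ⊓ U) := eq_of_cl (hfZ n) le_sup_left (by simp only [hk] at h0; omega)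
    have h2 : F.N (n + 1) ⊓ U ≤ Z n := by rw [h1]; exact le_sup_right
    have h3 : F.N (n + 2) ⊓ U ≤ Z (n + 1) := by
      refine (hIU n hn).trans ((Submodule.smul_mono le_rfl h2).trans ?_)
      simp only [hZ]
      rw [Submodule.smul_sup, ← Submodule.map_smul'']
      apply sup_le_sup
      · exact le_inf ((Submodule.smul_mono le_rfl inf_le_left).trans (smul_RR_le F _))
          ((Submodule.smul_mono le_rfl inf_le_right).trans (F.smul_le _))
      · exact Submodule.map_mono (F.smul_le n)
    simp only [hk]
    rw [show n + 1 + 1 = n + 2 from rfl, sup_eq_left.mpr h3]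
    simp
  have hkq : ∀ n, s' ≤ n → k n = 0 → q n = 0 := by
    intro n hn h0
    have hall : ∀ i, k (n + i) = 0 := by
      intro i
      induction i with
      | zero => exact h0
      | succ i ih => exact hkstep (n + i) (by omega) ih
    have hall2 : ∀ i, q (n + i) = q n := by
      intro i
      induction i with
      | zero => rfl
      | succ i ih =>
        have := e3 (n + i) (by omega)
        rw [hall i] at this
        rw [← ih, ← add_assoc]
        linarith
    rw [← hall2 c]
    exact hqC _ (by omega) (by omega)
  have hqB : ∀ i : ℕ, q (s' + i) ≤ max 0 ((B : ℤ) - i) := by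
    intro i
    induction i with
    | zero =>
      have h1 := hB s' le_rfl
      have h2 := hg0 s'
      have h3 := le_abs_self (p s')
      simp only [hq, add_zero, Nat.cast_zero, sub_zero]
      exact le_max_of_le_right (by linarith)
    | succ i ih =>
      have h1 := e3 (s' + i) (by omega)
      have h2 := hk0 (s' + i)
      have h3 := hqnn (s' + i + 1) (by omega)
      rw [← add_assoc]
      by_cases hz : k (s' + i) = 0
      · have := hkq _ (by omega) hz
        exact le_max_of_le_left (by linarith)
      · push_cast
        rcases le_max_iff.mp ih with h | h
        · omega
        · exact le_max_of_le_right (by omega)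
  have hqs : ∀ n, s' + B ≤ n → q n = 0 := by
    intro n hn
    obtain ⟨i, rfl⟩ := Nat.exists_eq_add_of_le (show s' ≤ n by omega)
    have h1 := hqB i
    have h2 := hqnn (s' + i) (by omega)
    rw [max_eq_left (by omega)] at h1
    omega
  have hks : ∀ n, s' + B ≤ n → k n = 0 := by
    intro n hn
    rw [← e3 n (by omega), hqs n hn, hqs (n + 1) (by omega)]; rfl
  have main : ∀ n, s' + B ≤ n → RR F n = F.N n ∧ F.N (n + 1) ⊓ U ≤ (F.N n).map Y := by
    refine downward (fun n => RR F n = F.N n ∧ F.N (n + 1) ⊓ U ≤ (F.N n).map Y) _ c ?_ ?_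
    · intro n hn
      refine ⟨RR_eq_of_le F hy hsup n hn, ?_⟩
      rintro u ⟨hu, huU⟩
      obtain ⟨v, -, rfl⟩ := hU (n + 1) (by omega) ⟨huU, hu⟩
      exact Submodule.mem_map_of_mem (hsup n hn v (by simpa [Yap] using hu))
    · intro n hn ih
      have h1 : F.N (n + 1) ⊓ U ≤ (F.N n).map Y := by
        have h0 := hks n hn
        have h1 : Z n = Z n ⊔ (F.N (n + 1) ⊓ U) := eq_of_cl (hfZ n) le_sup_left (by simp only [hk] at h0; omega)
        have h2 : F.N (n + 1) ⊓ U ≤ Z n := by rw [h1]; exact le_sup_right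
        rintro u ⟨hu, huU⟩
        obtain ⟨a, ha, b, hb, rfl⟩ := Submodule.mem_sup.mp (h2 ⟨hu, huU⟩)
        have ha' : a ∈ F.N (n + 2) := by
          have := ha.1
          rwa [(ih (n + 2) (by omega)).1] at this
        have haU : a ∈ U := by
          have := sub_mem huU (hmapY _ hb)
          simpa using this
        have h5 := (ih (n + 1) (by omega)).2 ⟨ha', haU⟩
        exact add_mem (Submodule.map_mono (F.mono n) h5) hb
      refine ⟨?_, h1⟩
      apply le_antisymm _ (le_RR F n)
      intro u hu
      have h2 : u ∈ F.N n ⊔ U := by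
        obtain ⟨j, hj⟩ := hu
        have : π u ∈ F' n := by
          apply hR.r1 _ (by omega) _ j
          intro a ha
          rw [hF', ← map_smul]
          exact Submodule.mem_map_of_mem (hj j le_rfl a ha)
        rw [hF'] at this
        rw [hUdef, ← Submodule.comap_map_eq]
        exact this
      obtain ⟨v, hv, w, hw, rfl⟩ := Submodule.mem_sup.mp h2
      have hwR : w ∈ RR F n := by
        have := sub_mem hu (le_RR F n hv)
        simpa using this
      have hyw : y • w ∈ F.N (n + 1) := by
        rw [← (ih (n + 1) (by omega)).1]
        exact smul_RR_le F n (Submodule.smul_mem_smul hy hwR)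
      obtain ⟨v', hv', hvw⟩ := h1 ⟨hyw, U.smul_mem y hw⟩
      rw [Yap] at hvw
      have : v' = w := by
        have := hreg (v' - w) (by rw [smul_sub, hvw, sub_self])
        exact sub_eq_zero.mp this
      exact add_mem hv (this ▸ hv')
  have hyJ : y ∈ Ideal.span {y} ⊔ J' := Ideal.mem_sup_left (Ideal.mem_span_singleton_self y)
  refine ⟨⟨sup_le ((Ideal.span_singleton_le_iff_mem I).mpr hy) hR.hJ, ?_, ?_, ?_⟩, ?_⟩
  · intro n hn u j h
    rw [← (main n hn).1]
    exact mem_RR_of j h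
  · intro n hn
    have hJF : J' • F.N n ≤ F.N (n + 1) := (Submodule.smul_mono_left hR.hJ).trans (F.smul_le n)
    have h1 : F.N (n + 1) ≤ J' • F.N n ⊔ (U ⊓ F.N (n + 1)) := by
      apply le_smul_sup π _ hJF
      rw [← hF', ← hF']
      exact hR.r3 n (by omega)
    refine h1.trans (sup_le (Submodule.smul_mono_left le_sup_right) ?_)
    rw [inf_comm]
    refine (main n hn).2.trans ?_
    rw [Submodule.map_le_iff_le_comap]
    intro u hu
    simp only [Submodule.mem_comap, Yap]
    exact Submodule.smul_mem_smul hyJ hu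
  · intro n hn Q _ _ ρ X1 X0 hX1 hX0 hJX
    rintro u ⟨huk, hu⟩
    rw [Submodule.sup_smul, Submodule.ideal_span_singleton_smul] at hu
    obtain ⟨a, ha, v, hv, rfl⟩ := Submodule.mem_sup.mp hu
    obtain ⟨x1, hx1, rfl⟩ := (Submodule.mem_smul_pointwise_iff_exists _ _ _).mp ha
    replace huk : ρ (y • x1 + v) = 0 := huk
    rw [map_add, map_smul] at huk
    have hvk : v ∈ LinearMap.ker (π ∘ₗ ρ) := by
      have h1 := congrArg π huk
      rw [map_add, hyU, zero_add, map_zero] at h1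
      exact h1
    have hv2 := hR.r4 n (by omega) Q (π ∘ₗ ρ) X1 X0 (by rw [Submodule.map_comp, hX1, hF'])
      (by rw [Submodule.map_comp, hX0, hF']) ((Submodule.smul_mono_left le_sup_right).trans hJX) ⟨hvk, hv⟩
    have hK : LinearMap.ker (π ∘ₗ ρ) ⊓ X1 ≤ X0.map (LinearMap.lsmul A Q y) ⊔ (LinearMap.ker ρ ⊓ X1) := by
      rintro w ⟨hwk, hw⟩
      have h1 : ρ w ∈ F.N (n + 1) := hX1 ▸ Submodule.mem_map_of_mem hw
      obtain ⟨z', hz', hz2⟩ := (main n hn).2 ⟨h1, hwk⟩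
      rw [← hX0] at hz'
      obtain ⟨z, hz, rfl⟩ := hz'
      rw [Submodule.mem_sup]
      refine ⟨y • z, ⟨z, hz, by simp⟩, w - y • z, ⟨?_, ?_⟩, by abel⟩
      · change ρ (w - y • z) = 0
        rw [map_sub, map_smul, ← hz2, Yap, sub_self]
      · exact sub_mem hw (hJX (Submodule.smul_mem_smul hyJ hz))
    have hv3 := Submodule.smul_mono le_rfl hK hv2
    rw [Submodule.smul_sup, ← Submodule.map_smul''] at hv3
    obtain ⟨b, hb, v', hv', rfl⟩ := Submodule.mem_sup.mp hv3
    obtain ⟨w, hw, rfl⟩ := hb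
    simp only [LinearMap.lsmul_apply] at huk ⊢
    have hv'0 : ρ v' = 0 := (Submodule.smul_le_right.trans inf_le_left) hv'
    rw [map_add, hv'0, add_zero, map_smul, ← smul_add, ← map_add] at huk
    have h6 := hreg _ huk
    have hwX : w ∈ X1 := hJX (Submodule.smul_mono_left le_sup_right hw)
    rw [← add_assoc, ← smul_add]
    exact add_mem (Submodule.smul_mem_smul hyJ ⟨h6, add_mem hx1 hwX⟩)
      (Submodule.smul_mono_left le_sup_right hv')
  · set f : ℕ → ℤ := fun n => cl (F.N (n + 1)) - cl (F.N n) with hf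
    have hsum : ∀ n, ∑ j ∈ Finset.range n, f j = cl (F.N n) := by
      intro n
      rw [hf, Finset.sum_range_sub (fun n => cl (F.N n)), hF0, cl_top, sub_zero]
    have hfp : ∀ n, s' + B ≤ n → f n = p n := by
      intro n hn
      have h1 := hqs n hn
      have h2 : Xs n = F.N (n + 1) := by
        simp only [hXs]
        rw [(main (n + 1) (by omega)).1]
        exact inf_eq_left.mpr (F.mono n)
      simp only [hq, hg, h2] at h1
      simp only [hf]
      linarith
    have hfg : ∀ n, g n ≤ f n := by
      intro n
      have := cl_anti (hfin (n + 1)) (hFXs n)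
      simp only [hg, hf]
      linarith
    refine ⟨∑ j ∈ Finset.range (s' + B), (f j - p j), ?_, ?_⟩
    · rw [Finset.sum_range_add]
      have b1 : |∑ j ∈ Finset.range s', (f j - p j)| ≤ s' * (2 * B) := by
        refine (Finset.abs_sum_le_sum_abs _ _).trans ?_
        refine (Finset.sum_le_card_nsmul _ _ (2 * (B : ℤ)) ?_).trans (by simp)
        intro j hj
        have hj' : j < s' := Finset.mem_range.mp hj
        have h1 := (hle j).1
        have h2 := hH'mono (show j + 1 ≤ s' + 1 by omega)
        have h3 := hp s' (by omega)
        have h4 := hB s' le_rfl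
        have h5 := hB j hj'.le
        have h6 := (hg0 j).trans (hfg j)
        simp only [hH'] at h1 h2
        rw [abs_le] at h4 h5 ⊢
        simp only [hf] at h6 ⊢
        constructor <;> linarith [h4.1, h4.2, h5.1, h5.2]
      have b2 : 2 * |∑ j ∈ Finset.range B, (f (s' + j) - p (s' + j))| ≤ B * (B + 1) := by
        have h0 : |∑ j ∈ Finset.range B, (f (s' + j) - p (s' + j))| ≤ ∑ j ∈ Finset.range B, ((B : ℤ) - j) := by
          refine (Finset.abs_sum_le_sum_abs _ _).trans (Finset.sum_le_sum ?_)
          intro j hj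
          have hj' : j < B := Finset.mem_range.mp hj
          have h1 := (hle (s' + j)).1
          have h3 := hp (s' + j) (by omega)
          have h4 := hqB j
          have h6 := hfg (s' + j)
          rw [max_eq_right (by omega)] at h4
          simp only [hH'] at h1
          simp only [hq] at h4
          rw [abs_le]
          simp only [hf] at h6 ⊢
          constructor <;> linarith
        have h1 : ∀ b : ℕ, 2 * ∑ j ∈ Finset.range b, ((b : ℤ) - j) = b * (b + 1) := by
          intro b
          rw [Finset.sum_sub_distrib]
          have := Finset.sum_range_id_mul_two b
          have h2 : (∑ j ∈ Finset.range b, (j : ℤ)) * 2 = b * (b - 1) := by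
            rcases b with _ | b
            · simp
            · have h3 := congrArg (fun n : ℕ => (n : ℤ)) this
              push_cast at h3
              push_cast
              simpa using h3
          simp only [Finset.sum_const, Finset.card_range, nsmul_eq_mul]
          linarith
        linarith [h1 B]
      have := abs_add_le (∑ j ∈ Finset.range s', (f j - p j)) (∑ j ∈ Finset.range B, (f (s' + j) - p (s' + j)))
      linarith
    · intro n hn
      obtain ⟨i, rfl⟩ := Nat.exists_eq_add_of_le hn
      have hA := Finset.sum_range_add f (s' + B) i
      have hA' := Finset.sum_range_add p (s' + B) i
      have hS : ∑ j ∈ Finset.range (s' + B), (f j - p j) =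
          ∑ j ∈ Finset.range (s' + B), f j - ∑ j ∈ Finset.range (s' + B), p j :=
        Finset.sum_sub_distrib f p
      rw [← hsum, hS]
      have : ∑ x ∈ Finset.range i, f (s' + B + x) = ∑ x ∈ Finset.range i, p (s' + B + x) :=
        Finset.sum_congr rfl fun x _ => hfp _ (by omega)
      rw [hA, hA', this]
      ring

end Step
end FC

namespace FC
section Loc
variable {A : Type u} [CommRing A] {N : Type u} [AddCommGroup N] [Module A N]

theorem mem_lcZero {J : Ideal A} {u : N} : u ∈ lcZero J N ↔ ∃ k, ∀ a ∈ J ^ k, a • u = 0 := by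
  rw [lcZero, Submodule.mem_iSup_of_directed]
  · simp [Submodule.mem_torsionBySet_iff]
  · intro i j
    refine ⟨max i j, ?_, ?_⟩
    · exact Submodule.torsionBySet_le_torsionBySet_of_subset (Ideal.pow_le_pow_right (le_max_left _ _))
    · exact Submodule.torsionBySet_le_torsionBySet_of_subset (Ideal.pow_le_pow_right (le_max_right _ _))

theorem quot_good {I : Ideal A} {F : I.Filtration N} (hF : F.IsGood) (p : Submodule A N) :
    (F.quot p).IsGood := by
  refine ⟨?_, ?_⟩
  · simp [Ideal.Filtration.quot, hF.1]
  · obtain ⟨n0, h⟩ := hF.2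
    refine ⟨n0, fun n hn => ?_⟩
    simp only [Ideal.Filtration.quot]
    rw [← Submodule.map_smul'', h n hn]

theorem adic_good (I : Ideal A) : (Ideal.stableFiltration I (⊤ : Submodule A N)).IsGood :=
  ⟨by simp [Ideal.stableFiltration], Ideal.stableFiltration_stable I ⊤⟩

variable [IsLocalRing A] [IsNoetherianRing A]

theorem IsMaxPrimary.le {I : Ideal A} (hI : IsMaxPrimary I) : I ≤ maximalIdeal A :=
  hI.2 ▸ Ideal.le_radical

theorem IsMaxPrimary.pow {I : Ideal A} (hI : IsMaxPrimary I) : ∃ k, maximalIdeal A ^ k ≤ I :=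
  hI.2 ▸ Ideal.exists_radical_pow_le_of_fg I (IsNoetherian.noetherian _)

theorem isArtinian_pow (k : ℕ) : IsArtinianRing (A ⧸ (maximalIdeal A ^ k)) := by
  rw [isArtinianRing_iff_krullDimLE_zero, Ring.krullDimLE_zero_iff]
  intro P hP
  have h1 : (P.comap (Ideal.Quotient.mk (maximalIdeal A ^ k))).IsPrime := Ideal.IsPrime.comap _
  have h2 : maximalIdeal A ≤ P.comap (Ideal.Quotient.mk (maximalIdeal A ^ k)) := by
    apply Ideal.IsPrime.le_of_pow_le (n := k)
    intro x hx
    rw [Ideal.mem_comap, Ideal.Quotient.eq_zero_iff_mem.mpr hx]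
    exact zero_mem _
  have h3 : P.comap (Ideal.Quotient.mk (maximalIdeal A ^ k)) = maximalIdeal A :=
    le_antisymm (le_maximalIdeal h1.ne_top) h2
  have h4 : (P.comap (Ideal.Quotient.mk (maximalIdeal A ^ k))).IsMaximal := by
    rw [h3]; infer_instance
  have h5 := Ideal.map_eq_top_or_isMaximal_of_surjective (Ideal.Quotient.mk (maximalIdeal A ^ k))
    Ideal.Quotient.mk_surjective h4
  rw [Ideal.map_comap_of_surjective _ Ideal.Quotient.mk_surjective] at h5
  exact h5.resolve_left hP.ne_top

theorem finite_length_of_pow [Module.Finite A N] (k : ℕ)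
    (h : ∀ a ∈ maximalIdeal A ^ k, ∀ u : N, a • u = 0) : Module.length A N ≠ ⊤ := by
  have hT : Module.IsTorsionBySet A N ((maximalIdeal A ^ k : Ideal A) : Set A) := by
    intro u a
    exact h a.1 a.2 u
  let := hT.module
  have : IsScalarTower A (A ⧸ (maximalIdeal A ^ k)) N := hT.isScalarTower
  have := isArtinian_pow (A := A) k
  have : Module.Finite (A ⧸ (maximalIdeal A ^ k)) N := Module.Finite.of_restrictScalars_finite A _ N
  have : IsArtinian (A ⧸ (maximalIdeal A ^ k)) N := inferInstance
  have : IsArtinian A N :=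
    isArtinian_of_surjective_algebraMap (R := A ⧸ (maximalIdeal A ^ k)) (S := A)
      Ideal.Quotient.mk_surjective
  exact Module.length_ne_top

variable [Module.Finite A N]

theorem lcZero_pow (J : Ideal A) : ∃ k, ∀ a ∈ J ^ k, ∀ u ∈ lcZero J N, a • u = 0 := by
  obtain ⟨S, hS⟩ := IsNoetherian.noetherian (lcZero J N)
  have h1 : ∀ u : N, ∃ k, u ∈ lcZero J N → ∀ a ∈ J ^ k, a • u = 0 := by
    intro u
    by_cases hu : u ∈ lcZero J N
    · obtain ⟨k, hk⟩ := mem_lcZero.mp hu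
      exact ⟨k, fun _ => hk⟩
    · exact ⟨0, fun h => absurd h hu⟩
  choose k hk using h1
  refine ⟨S.sup k, fun a ha u hu => ?_⟩
  have : lcZero J N ≤ LinearMap.ker (LinearMap.lsmul A N a) := by
    rw [← hS, Submodule.span_le]
    intro v hv
    have hv' : v ∈ lcZero J N := hS ▸ Submodule.subset_span hv
    have := hk v hv' a (Ideal.pow_le_pow_right (Finset.le_sup (f := k) hv) ha)
    simpa using this
  simpa using this hu

theorem lcZero_quot (J : Ideal A) : lcZero J (N ⧸ lcZero J N) = ⊥ := by
  rw [eq_bot_iff]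
  intro u hu
  obtain ⟨v, rfl⟩ := Submodule.mkQ_surjective _ u
  obtain ⟨k, hk⟩ := mem_lcZero.mp hu
  obtain ⟨k', hk'⟩ := lcZero_pow (N := N) J
  simp only [Submodule.mkQ_apply, Submodule.mem_bot, Submodule.Quotient.mk_eq_zero]
  rw [mem_lcZero]
  refine ⟨k' + k, fun a ha => ?_⟩
  rw [pow_add] at ha
  refine Submodule.mul_induction_on ha ?_ ?_
  · intro m hm b hb
    rw [mul_smul]
    apply hk' m hm
    have := hk b hb
    rwa [← map_smul, Submodule.mkQ_apply, Submodule.Quotient.mk_eq_zero] at this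
  · intro x y hx hy
    rw [add_smul, hx, hy, add_zero]

theorem lcZero_length : Module.length A (lcZero (maximalIdeal A) N) ≠ ⊤ := by
  obtain ⟨k, hk⟩ := lcZero_pow (N := N) (maximalIdeal A)
  apply finite_length_of_pow k
  intro a ha u
  ext
  simpa using hk a ha u u.2

variable {I : Ideal A}

theorem good_fin (hI : IsMaxPrimary I) {F : I.Filtration N} (hF : F.IsGood) (n : ℕ) : FinCl (F.N n) := by
  obtain ⟨k, hk⟩ := IsMaxPrimary.pow hI
  apply finite_length_of_pow (k * n)
  intro a ha u
  obtain ⟨v, rfl⟩ := Submodule.mkQ_surjective _ u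
  rw [← map_smul, Submodule.mkQ_apply, Submodule.Quotient.mk_eq_zero]
  have h1 : a ∈ I ^ n := by
    rw [pow_mul] at ha
    exact Ideal.pow_right_mono hk n ha
  have := pow_smul_mem F (n := 0) h1 (u := v) (by rw [hF.1]; trivial)
  simpa using this

theorem good_sep (hI : IsMaxPrimary I) {F : I.Filtration N} (hF : F.IsGood) (c : ℕ) (u : N)
    (h : ∀ n, c ≤ n → u ∈ F.N n) : u = 0 := by
  obtain ⟨n0, h0⟩ := hF.2.exists_pow_smul_eq
  have h1 := Ideal.iInf_pow_smul_eq_bot_of_isLocalRing (M := N) I hI.1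
  rw [← Submodule.mem_bot A, ← h1, Submodule.mem_iInf]
  intro i
  have h2 : u ∈ F.N (n0 + (i + c)) := h _ (by omega)
  rw [h0] at h2
  exact Submodule.smul_mono (Ideal.pow_le_pow_right (by omega)) le_top h2

theorem artin_rees {F : I.Filtration N} (hF : F.IsGood) (X : Submodule A N) :
    ∃ n0, ∀ k, F.N (n0 + k) ⊓ X ≤ I ^ k • X := by
  obtain ⟨n0, h⟩ := (hF.2.inter_right (I.trivialFiltration X)).exists_pow_smul_eq
  refine ⟨n0, fun k => ?_⟩
  have h1 := h k
  simp only [Ideal.Filtration.inf_N, Pi.inf_apply, Ideal.trivialFiltration] at h1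
  rw [h1]
  exact Submodule.smul_mono le_rfl inf_le_right

theorem lcZero_inf (hI : IsMaxPrimary I) {F : I.Filtration N} (hF : F.IsGood) :
    ∃ c, ∀ n, c ≤ n → lcZero (maximalIdeal A) N ⊓ F.N n = ⊥ := by
  obtain ⟨n0, h⟩ := artin_rees hF (lcZero (maximalIdeal A) N)
  obtain ⟨k, hk⟩ := lcZero_pow (N := N) (maximalIdeal A)
  refine ⟨n0 + k, fun n hn => ?_⟩
  rw [eq_bot_iff, inf_comm]
  obtain ⟨i, rfl⟩ := Nat.exists_eq_add_of_le hn
  rw [add_assoc]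
  refine (h (k + i)).trans ?_
  rw [Submodule.smul_le]
  intro a ha u hu
  rw [Submodule.mem_bot]
  exact hk a (Ideal.pow_right_mono (IsMaxPrimary.le hI) _ (Ideal.pow_le_pow_right (by omega) ha)) u hu

theorem fr_regular (hI : IsMaxPrimary I) {F : I.Filtration N} (hF : F.IsGood)
    (hN : lcZero (maximalIdeal A) N = ⊥) {y : A} (h : F.FilterRegular y) (u : N) (hu : y • u = 0) :
    u = 0 := by
  obtain ⟨c, hc⟩ := eventually_atTop.mp h
  have h1 : ∀ v ∈ F.N c, y • v = 0 → v = 0 := by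
    intro v hv hyv
    apply good_sep hI hF c
    intro n hn
    induction n, hn using Nat.le_induction with
    | base => exact hv
    | succ n hn ih =>
      rw [← hc n hn]
      exact ⟨by simp [hyv], ih⟩
  obtain ⟨k, hk⟩ := IsMaxPrimary.pow hI
  rw [← Submodule.mem_bot A, ← hN, mem_lcZero]
  refine ⟨k * c, fun a ha => ?_⟩
  rw [pow_mul] at ha
  apply h1
  · have := pow_smul_mem F (n := 0) (Ideal.pow_right_mono hk c ha) (u := u) (by rw [hF.1]; trivial)
    simpa using this
  · rw [smul_comm, hu, smul_zero]

theorem fr_sup (hI : IsMaxPrimary I) {F : I.Filtration N} (hF : F.IsGood)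
    (hN : lcZero (maximalIdeal A) N = ⊥) {y : A} (h : F.FilterRegular y) :
    ∃ c, ∀ n, c ≤ n → ∀ u, y • u ∈ F.N (n + 1) → u ∈ F.N n := by
  have hreg := fr_regular hI hF hN h
  obtain ⟨c, hc⟩ := eventually_atTop.mp h
  obtain ⟨n0, h0⟩ := artin_rees hF ((⊤ : Submodule A N).map (LinearMap.lsmul A N y))
  refine ⟨c + n0, fun n hn u hu => ?_⟩
  obtain ⟨k, hk⟩ := Nat.exists_eq_add_of_le (show n0 ≤ n + 1 by omega)
  have h1 : y • u ∈ F.N (n0 + k) := hk ▸ hu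
  have h2 := h0 k ⟨h1, ⟨u, trivial, by simp⟩⟩
  rw [← Submodule.map_smul''] at h2
  obtain ⟨v, hv, hvu⟩ := h2
  have hvu' : v = u := sub_eq_zero.mp (hreg (v - u) (by
    rw [smul_sub, sub_eq_zero]; simpa using hvu))
  have h3 : u ∈ F.N k := by
    rw [← hvu']
    have := F.pow_smul_le k 0
    rw [hF.1, add_zero] at this
    exact this hv
  have h4 : ∀ i, k + i ≤ n → u ∈ F.N (k + i) := by
    intro i
    induction i with
    | zero => intro _; exact h3
    | succ i ih =>
      intro hi
      have h5 := ih (by omega)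
      rw [← add_assoc, ← hc (k + i) (by omega)]
      exact ⟨F.antitone (show k + i + 2 ≤ n + 1 by omega) (by simpa using hu), h5⟩
  by_cases hkn : k ≤ n
  · have := h4 (n - k) (by omega)
    rwa [show k + (n - k) = n by omega] at this
  · exact F.antitone (show n ≤ k by omega) h3

end Loc
end FC

namespace FC
section Avoid
variable {A : Type u} [CommRing A]

theorem avoid [IsLocalRing A] [Infinite (ResidueField A)] {X : Type*} [AddCommGroup X] [Module A X]
    (S : Finset (Submodule A X)) (h : ∀ V ∈ S, V ≠ ⊤) : ∃ y : X, ∀ V ∈ S, y ∉ V := by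
  by_contra! hc
  have hcov : ⋃ V ∈ S, ((id V : Submodule A X) : Set X) = Set.univ := by
    ext y
    simpa using hc y
  obtain ⟨V, hV, hfi⟩ := Submodule.exists_finiteIndex_of_cover hcov
  have : (V.toAddSubgroup).FiniteIndex := hfi
  have : Finite (X ⧸ V) := AddSubgroup.finite_quotient_of_finiteIndex (H := V.toAddSubgroup)
  obtain ⟨u, hu⟩ : ∃ u, u ∉ V := by
    by_contra! hc
    exact h V hV (by ext; simp [hc])
  let f : A →ₗ[A] X ⧸ V := LinearMap.toSpanSingleton A _ (V.mkQ u)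
  have hk : LinearMap.ker f ≤ maximalIdeal A := by
    apply le_maximalIdeal
    intro ht
    have : (1 : A) ∈ LinearMap.ker f := by rw [ht]; trivial
    rw [LinearMap.mem_ker] at this
    simp only [f, LinearMap.toSpanSingleton_apply, one_smul, Submodule.mkQ_apply,
      Submodule.Quotient.mk_eq_zero] at this
    exact hu this
  have hf : Finite (A ⧸ LinearMap.ker f) := by
    have e := f.quotKerEquivRange
    have : Finite (LinearMap.range f) := inferInstance
    exact Finite.of_equiv _ e.symm.toEquiv
  have : Finite (ResidueField A) := by
    refine Finite.of_surjective (α := A ⧸ LinearMap.ker f) (Ideal.Quotient.factor hk) ?_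
    exact Ideal.Quotient.factor_surjective hk
  exact not_finite (ResidueField A)

theorem pow_kill {R : Type*} [CommRing R] [IsNoetherianRing R] {G : Type*} [AddCommGroup G] [Module R G]
    [Module.Finite R G] (z : R) (P0 : Ideal R)
    (h : ∀ P ∈ associatedPrimes R G, z ∈ P → P0 ≤ P) :
    ∃ k, ∀ r ∈ P0 ^ k, ∀ g : G, z • g = 0 → r • g = 0 := by
  let T : Submodule R G := LinearMap.ker (LinearMap.lsmul R G z)
  have hle : P0 ≤ (Module.annihilator R T).radical := by
    rw [← Ideal.sInf_minimalPrimes]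
    apply le_sInf
    intro P hP
    apply h P
    · exact associatedPrimes.subset_of_injective (f := T.subtype) T.injective_subtype
        (Module.associatedPrimes.minimalPrimes_annihilator_subset_associatedPrimes R T hP)
    · apply hP.1.2
      rw [Module.mem_annihilator]
      rintro ⟨g, hg⟩
      ext
      exact hg
  obtain ⟨k, hk⟩ := Ideal.exists_pow_le_of_le_radical_of_fg hle (IsNoetherian.noetherian _)
  refine ⟨k, fun r hr g hg => ?_⟩
  have := Module.mem_annihilator.mp (hk hr) ⟨g, hg⟩
  simpa using congrArg Subtype.val this
end Avoid

section FR
variable {A : Type u} [CommRing A] {N : Type u} [AddCommGroup N] [Module A N] {I : Ideal A}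

/-- shifted filtration -/
def shift (F : I.Filtration N) : I.Filtration N where
  N n := F.N (n + 1)
  mono n := F.mono (n + 1)
  smul_le n := F.smul_le (n + 1)

/-- `a ↦ a t` -/
noncomputable def phi (I : Ideal A) : I →ₗ[A] reesAlgebra I where
  toFun a := ⟨Polynomial.monomial 1 a.1, reesAlgebra.monomial_mem.mpr (by simpa using a.2)⟩
  map_add' a b := by ext1; simp
  map_smul' a b := by ext1; simp [Polynomial.smul_monomial]

/-- the irrelevant ideal (generated in degree one) -/
noncomputable def irr (I : Ideal A) : Ideal (reesAlgebra I) := Ideal.span (Set.range (phi I))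

theorem mono_irr (j : ℕ) : ∀ (b : A) (hb : b ∈ I ^ j),
    (⟨Polynomial.monomial j b, reesAlgebra.monomial_mem.mpr hb⟩ : reesAlgebra I) ∈ irr I ^ j := by
  induction j with
  | zero => intro b hb; simp
  | succ j ih =>
    intro b hb
    have key : ∀ b (hb : b ∈ I ^ j * I), ∃ w ∈ irr I ^ (j+1), (w : Polynomial A) = Polynomial.monomial (j+1) b := by
      intro b hb
      induction hb using Submodule.mul_induction_on' with
      | mem_mul_mem m hm n hn =>
        refine ⟨⟨Polynomial.monomial j m, reesAlgebra.monomial_mem.mpr hm⟩ * phi I ⟨n, hn⟩, ?_, ?_⟩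
        · rw [pow_succ]
          exact Ideal.mul_mem_mul (ih m hm) (Ideal.subset_span ⟨⟨n, hn⟩, rfl⟩)
        · simp [phi, Polynomial.monomial_mul_monomial]
      | add x _ y _ hx hy =>
        obtain ⟨w, hw, e⟩ := hx
        obtain ⟨w2, hw2, e2⟩ := hy
        exact ⟨w + w2, add_mem hw hw2, by simp [e, e2]⟩
    obtain ⟨w, hw, e⟩ := key b (by rwa [pow_succ] at hb)
    convert hw
    exact e.symm

variable [IsNoetherianRing A] [Module.Finite A N]

/-- associated graded module -/
noncomputable abbrev Gr (F : I.Filtration N) := F.submodule.map (shift F).submodule.mkQ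

theorem gr_fin {F : I.Filtration N} (hF : F.IsGood) : Module.Finite (reesAlgebra I) (Gr F) := by
  have : F.submodule.FG :=
    (Ideal.Filtration.submodule_fg_iff_stable F (fun i => IsNoetherian.noetherian _)).mpr hF.2
  exact Module.Finite.of_fg (this.map _)

theorem fr_of {F : I.Filtration N} (hF : F.IsGood) (y : I)
    (h : ∀ P ∈ associatedPrimes (reesAlgebra I) (Gr F), phi I y ∈ P → irr I ≤ P) :
    F.FilterRegular y := by
  have := gr_fin hF
  obtain ⟨k, hk⟩ := pow_kill (G := Gr F) (phi I y) (irr I) h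
  have hS : F.submodule.FG :=
    (Ideal.Filtration.submodule_fg_iff_stable F (fun i => IsNoetherian.noetherian _)).mpr hF.2
  have hN : IsNoetherian (reesAlgebra I) F.submodule := isNoetherian_of_fg_of_noetherian _ hS
  let T : Submodule (reesAlgebra I) (PolynomialModule A N) :=
    F.submodule ⊓ (shift F).submodule.comap (LinearMap.lsmul (reesAlgebra I) _ (phi I y))
  have hT : T.FG := by
    have h1 : (T.comap F.submodule.subtype).FG := IsNoetherian.noetherian _
    have h2 := h1.map F.submodule.subtype
    rwa [Submodule.map_comap_subtype, inf_eq_right.mpr inf_le_left] at h2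
  have hkT : ∀ r ∈ irr I ^ k, ∀ p ∈ T, r • p ∈ (shift F).submodule := by
    intro r hr p hp
    have := hk r hr ⟨(shift F).submodule.mkQ p, Submodule.mem_map_of_mem hp.1⟩ (by
      ext1
      change phi I y • (shift F).submodule.mkQ p = 0
      rw [← map_smul, Submodule.mkQ_apply, Submodule.Quotient.mk_eq_zero]
      exact hp.2)
    have h2 : r • (shift F).submodule.mkQ p = 0 := congrArg Subtype.val this
    rw [← map_smul, Submodule.mkQ_apply, Submodule.Quotient.mk_eq_zero] at h2
    exact h2
  obtain ⟨s, hs⟩ := hT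
  obtain ⟨Dg, hDg⟩ : ∃ Dg, ∀ p ∈ s, ∀ n, Dg ≤ n → p.coeff n = 0 := by
    refine ⟨s.sup (fun p => p.coeff.support.sup id + 1), fun p hp n hn => ?_⟩
    by_contra hne
    have h1 : n ≤ p.coeff.support.sup id :=
      Finset.le_sup (f := id) (Finsupp.mem_support_iff.mpr hne)
    have h2 : p.coeff.support.sup id + 1 ≤ s.sup (fun p => p.coeff.support.sup id + 1) :=
      Finset.le_sup (f := fun p : PolynomialModule A N => p.coeff.support.sup id + 1) hp
    omega
  have key : ∀ p ∈ T, ∀ n, k + Dg ≤ n → p.coeff n ∈ F.N (n + 1) := by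
    intro p hp n hn
    rw [← hs] at hp
    induction hp using Submodule.closure_induction with
    | zero => simp
    | add x y _ _ hx hy => simpa using add_mem hx hy
    | smul_mem r p hp =>
      have hpT : p ∈ T := by rw [← hs]; exact Submodule.subset_span hp
      rw [Subalgebra.smul_def, PolynomialModule.smul_apply]
      apply Submodule.sum_mem
      rintro ⟨j, l⟩ e
      rw [Finset.HasAntidiagonal.mem_antidiagonal] at e
      simp only at e ⊢
      by_cases hl : Dg ≤ l
      · rw [hDg p hp l hl]; simp
      · have hjk : k ≤ j := by omega
        have h1 := hkT _ (Ideal.pow_le_pow_right hjk (mono_irr j _ (r.2 j))) p hpT n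
        rw [Subalgebra.smul_def, PolynomialModule.monomial_smul_apply, if_pos (by omega)] at h1
        rwa [show n - j = l by omega] at h1
  refine eventually_atTop.mpr ⟨k + Dg, fun n hn => ?_⟩
  apply le_antisymm
  · rintro u ⟨hu1, hu2⟩
    have hu : PolynomialModule.single A n u ∈ T := by
      refine ⟨?_, ?_⟩
      · intro i
        rw [PolynomialModule.coeff_single, Finsupp.single_apply]
        split_ifs with hh
        · rwa [← hh]
        · exact zero_mem _
      · rw [SetLike.mem_coe, Submodule.mem_comap]
        intro i
        rw [LinearMap.lsmul_apply, Subalgebra.smul_def]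
        simp only [phi, LinearMap.coe_mk, AddHom.coe_mk, PolynomialModule.monomial_smul_single]
        rw [PolynomialModule.coeff_single, Finsupp.single_apply]
        split_ifs with hh
        · rw [← hh]
          have : (y : A) • u ∈ F.N (n + 2) := hu1
          simpa [shift, show 1 + n + 1 = n + 2 by omega] using this
        · exact zero_mem _
    simpa using key _ hu n hn
  · intro u hu
    refine ⟨?_, F.mono n hu⟩
    exact F.smul_le (n + 1) (Submodule.smul_mem_smul y.2 hu)

theorem exists_fr [IsLocalRing A] [Infinite (ResidueField A)] {ι : Type*} [Finite ι]
    (F : ι → I.Filtration N) (hF : ∀ k, (F k).IsGood) :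
    ∃ y ∈ I, ∀ k, (F k).FilterRegular y := by
  classical
  have hfin : (⋃ k, associatedPrimes (reesAlgebra I) (Gr (F k))).Finite := by
    apply Set.finite_iUnion
    intro k
    have := gr_fin (hF k)
    exact associatedPrimes.finite _ _
  let S : Finset (Submodule A I) :=
    (hfin.toFinset.image (fun P : Ideal (reesAlgebra I) => (P.restrictScalars A).comap (phi I))).filter (· ≠ ⊤)
  obtain ⟨y, hy⟩ := avoid S (by intro V hV; simp [S] at hV; exact hV.2)
  refine ⟨y, y.2, fun k => fr_of (hF k) y ?_⟩
  intro P hP hyP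
  by_contra hle
  refine hy ((P.restrictScalars A).comap (phi I)) ?_ hyP
  rw [Finset.mem_filter]
  refine ⟨Finset.mem_image_of_mem _ (hfin.mem_toFinset.mpr (Set.mem_iUnion.mpr ⟨k, hP⟩)), ?_⟩
  intro ht
  apply hle
  rw [irr, Ideal.span_le]
  rintro _ ⟨a, rfl⟩
  have : a ∈ (P.restrictScalars A).comap (phi I) := by rw [ht]; trivial
  exact this
end FR
end FC

namespace FC
section PHsec

/-- Hilbert polynomial with prescribed coefficients. -/
def PH (d : ℕ) (e : ℕ → ℤ) (n : ℕ) : ℤ :=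
  ∑ i ∈ Finset.range (d + 1), (-1) ^ i * e i * (Nat.multichoose n (d - i) : ℤ)

theorem PH_zero (e : ℕ → ℤ) (n : ℕ) : PH 0 e n = e 0 := by
  simp [PH]

theorem PH_succ_zero (d : ℕ) (e : ℕ → ℤ) : PH (d + 1) e 0 = (-1) ^ (d + 1) * e (d + 1) := by
  rw [PH, Finset.sum_range_succ, Finset.sum_eq_zero]
  · simp
  · intro i hi
    rw [Finset.mem_range] at hi
    obtain ⟨k, hk⟩ : ∃ k, d + 1 - i = k + 1 := ⟨d - i, by omega⟩
    rw [hk]; simp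

theorem PH_succ (d : ℕ) (e : ℕ → ℤ) (n : ℕ) :
    PH (d + 1) e (n + 1) = PH (d + 1) e n + PH d e (n + 1) := by
  unfold PH
  rw [Finset.sum_range_succ (n := d + 1), Finset.sum_range_succ (n := d + 1), add_right_comm,
    ← Finset.sum_add_distrib]
  congr 1
  · apply Finset.sum_congr rfl
    intro i hi
    rw [Finset.mem_range] at hi
    rw [show d + 1 - i = (d - i) + 1 by omega, Nat.multichoose_succ_succ]
    push_cast
    ring
  · simp

theorem PH_sum (d : ℕ) (e : ℕ → ℤ) (n : ℕ) :
    PH (d + 1) e n = (-1) ^ (d + 1) * e (d + 1) + ∑ j ∈ Finset.range n, PH d e (j + 1) := by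
  induction n with
  | zero => simp [PH_succ_zero]
  | succ n ih => rw [PH_succ, ih, Finset.sum_range_succ, add_assoc]

theorem PH_congr (d : ℕ) {e e' : ℕ → ℤ} (h : ∀ i, i ≤ d → e i = e' i) (n : ℕ) : PH d e n = PH d e' n := by
  apply Finset.sum_congr rfl
  intro i hi
  rw [Finset.mem_range] at hi
  rw [h i (by omega)]

theorem PH_sub (d : ℕ) (e e' : ℕ → ℤ) (n : ℕ) :
    PH d (fun i => e i - e' i) n = PH d e n - PH d e' n := by
  rw [PH, PH, PH, ← Finset.sum_sub_distrib]
  apply Finset.sum_congr rfl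
  intro i _
  ring

theorem PH_add (d : ℕ) (e e' : ℕ → ℤ) (n : ℕ) :
    PH d (fun i => e i + e' i) n = PH d e n + PH d e' n := by
  rw [PH, PH, PH, ← Finset.sum_add_distrib]
  apply Finset.sum_congr rfl
  intro i _
  ring

/-- if the leading coefficient vanishes the degree drops -/
theorem PH_shift (d : ℕ) (e : ℕ → ℤ) (h : e 0 = 0) (n : ℕ) :
    PH (d + 1) e n = - PH d (fun i => e (i + 1)) n := by
  rw [PH, Finset.sum_range_succ', PH, ← Finset.sum_neg_distrib, h]
  simp only [mul_zero, zero_mul, add_zero]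
  apply Finset.sum_congr rfl
  intro i _
  rw [show d + 1 - (i + 1) = d - i by omega]
  ring

theorem mc_le (n k : ℕ) : Nat.multichoose n (k + 1) ≤ n * Nat.multichoose n k := by
  induction n with
  | zero => simp
  | succ n ih =>
    rw [Nat.multichoose_succ_succ]
    have hm : Nat.multichoose n k ≤ Nat.multichoose (n + 1) k := by
      cases k with
      | zero => simp
      | succ k => rw [Nat.multichoose_succ_succ]; omega
    nlinarith

theorem mc_le_pow (n k : ℕ) : Nat.multichoose n k ≤ n ^ k := by
  induction k with
  | zero => simp
  | succ k ih =>
    calc _ ≤ n * Nat.multichoose n k := mc_le n k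
      _ ≤ n * n ^ k := Nat.mul_le_mul_left _ ih
      _ = _ := by ring

/-- bound for values -/
def bb (e : ℕ → ℤ) (s j : ℕ) : ℕ := ∑ i ∈ Finset.range (j + 1), (e i).natAbs * (s + 1) ^ (j - i)

theorem PH_bound (d : ℕ) (e : ℕ → ℤ) (s j : ℕ) (h : j ≤ s) : |PH d e (j + 1)| ≤ (bb e s d : ℕ) := by
  rw [PH, bb]
  push_cast
  refine (Finset.abs_sum_le_sum_abs _ _).trans (Finset.sum_le_sum fun i _ => ?_)
  rw [abs_mul, abs_mul, abs_pow, abs_neg, abs_one, one_pow, one_mul, Nat.abs_cast]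
  refine mul_le_mul_of_nonneg_left ?_ (abs_nonneg _)
  exact_mod_cast (mc_le_pow _ _).trans (Nat.pow_le_pow_left (by omega) _)

theorem PH_uniq0 (d : ℕ) : ∀ (f : ℕ → ℤ), (∀ᶠ n in atTop, PH d f n = 0) → ∀ i, i ≤ d → f i = 0 := by
  induction d with
  | zero =>
    intro f h i hi
    obtain ⟨n, hn⟩ := h.exists
    rw [PH_zero] at hn
    rwa [Nat.le_zero.mp hi]
  | succ d ih =>
    intro f h i hi
    obtain ⟨n0, hn⟩ := eventually_atTop.mp h
    have hlow : ∀ i, i ≤ d → f i = 0 := by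
      apply ih f
      refine eventually_atTop.mpr ⟨n0 + 1, fun n hn' => ?_⟩
      obtain ⟨m, rfl⟩ : ∃ m, n = m + 1 := ⟨n - 1, by omega⟩
      have h1 := PH_succ d f m
      rw [hn _ (by omega), hn _ (by omega)] at h1
      omega
    rcases Nat.lt_or_ge d i with h2 | h2
    · have : i = d + 1 := by omega
      subst this
      have h3 := PH_sum d f n0
      rw [hn _ le_rfl, Finset.sum_eq_zero, add_zero] at h3
      · have := h3.symm
        rcases mul_eq_zero.mp this with h4 | h4
        · exact absurd h4 (by simp)
        · exact h4
      · intro j _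
        rw [PH_congr d (e' := fun _ => 0) hlow]
        simp [PH]
    · exact hlow i h2

theorem PH_uniq (d : ℕ) (e e' : ℕ → ℤ) (h : ∀ᶠ n in atTop, PH d e n = PH d e' n) :
    ∀ i, i ≤ d → e i = e' i := by
  intro i hi
  have := PH_uniq0 d (fun i => e i - e' i) (h.mono fun n hn => by rw [PH_sub, hn, sub_self]) i hi
  simpa [sub_eq_zero] using this

theorem PH_pos (d : ℕ) (f : ℕ → ℤ) (h : 1 ≤ f 0) : ∀ᶠ n in atTop, 1 ≤ PH d f n := by
  induction d with
  | zero => exact Eventually.of_forall fun n => by rwa [PH_zero]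
  | succ d ih =>
    obtain ⟨n0, hn⟩ := eventually_atTop.mp ih
    have key : ∀ k : ℕ, PH (d + 1) f n0 + k ≤ PH (d + 1) f (n0 + k) := by
      intro k
      induction k with
      | zero => simp
      | succ k ihk =>
        have h1 := PH_succ d f (n0 + k)
        have h2 := hn (n0 + k + 1) (by omega)
        rw [← add_assoc, h1]
        push_cast
        linarith
    refine eventually_atTop.mpr ⟨n0 + (PH (d + 1) f n0).natAbs + 1, fun n hn' => ?_⟩
    have := key (n - n0)
    rw [show n0 + (n - n0) = n by omega] at this
    omega
end PHsec

section Seq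
/-- regularity indices -/
def sq (e : ℕ → ℤ) (s0 : ℕ) : ℕ → ℕ
  | 0 => s0
  | j + 1 => sq e s0 j + bb e (sq e s0 j) j

/-- twice the error bound -/
def Eb (e : ℕ → ℤ) (s0 : ℕ) : ℕ → ℕ
  | 0 => 0
  | j + 1 => 4 * sq e s0 j * bb e (sq e s0 j) j + bb e (sq e s0 j) j * (bb e (sq e s0 j) j + 1)

theorem bb_congr {e e' : ℕ → ℤ} (s j : ℕ) (h : ∀ i, i ≤ j → e i = e' i) : bb e s j = bb e' s j := by
  apply Finset.sum_congr rfl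
  intro i hi
  rw [Finset.mem_range] at hi
  rw [h i (by omega)]

theorem sq_congr {e e' : ℕ → ℤ} (s0 j : ℕ) (h : ∀ i, i < j → e i = e' i) : sq e s0 j = sq e' s0 j := by
  induction j with
  | zero => rfl
  | succ j ih =>
    rw [sq, sq, ih (fun i hi => h i (by omega)), bb_congr _ j (fun i hi => h i (by omega))]

theorem Eb_congr {e e' : ℕ → ℤ} (s0 j : ℕ) (h : ∀ i, i < j → e i = e' i) : Eb e s0 j = Eb e' s0 j := by
  cases j with
  | zero => rfl
  | succ j =>
    rw [Eb, Eb, sq_congr s0 j (fun i hi => h i (by omega)), bb_congr _ j (fun i hi => h i (by omega))]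

theorem le_sq (e : ℕ → ℤ) (s0 j : ℕ) : s0 ≤ sq e s0 j := by
  induction j with
  | zero => exact le_rfl
  | succ j ih => rw [sq]; omega
end Seq
end FC

namespace FC
section Chain
variable {A : Type u} [CommRing A] [IsLocalRing A]

/-- chain of filter regular elements -/
def Ok {I : Ideal A} {ι : Type} : (d : ℕ) → (M : Type u) → [AddCommGroup M] → [Module A M] →
    (ι → I.Filtration M) → (ℕ → ℕ) → Prop
  | 0, M, _, _, _, l => lcZero (maximalIdeal A) M = ⊤ ∧ Module.length A (lcZero (maximalIdeal A) M) = l 0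
  | d + 1, M, _, _, F, l => Module.length A (lcZero (maximalIdeal A) M) = l (d + 1) ∧
      ∃ y ∈ I, (∀ k, ((F k).quot (lcZero (maximalIdeal A) M)).FilterRegular y) ∧
        (∀ u : M ⧸ lcZero (maximalIdeal A) M, y • u = 0 → u = 0) ∧
        Ok d ((M ⧸ lcZero (maximalIdeal A) M) ⧸ (Ideal.span {y} • (⊤ : Submodule A (M ⧸ lcZero (maximalIdeal A) M))))
          (fun k => ((F k).quot (lcZero (maximalIdeal A) M)).quot _) l

theorem Ok.length {I : Ideal A} {ι : Type} {d : ℕ} {M : Type u} [AddCommGroup M] [Module A M]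
    {F : ι → I.Filtration M} {l : ℕ → ℕ} (h : Ok d M F l) :
    Module.length A (lcZero (maximalIdeal A) M) = l d := by
  cases d with
  | zero => exact h.2
  | succ d => exact h.1

theorem Ok.congr {I : Ideal A} {ι : Type} (d : ℕ) : ∀ (M : Type u) [AddCommGroup M] [Module A M]
    (F : ι → I.Filtration M) (l l' : ℕ → ℕ), (∀ i, i ≤ d → l i = l' i) → Ok d M F l → Ok d M F l' := by
  induction d with
  | zero =>
    intro M _ _ F l l' h hO
    exact ⟨hO.1, by rw [hO.2, h 0 le_rfl]⟩
  | succ d ih =>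
    intro M _ _ F l l' h hO
    obtain ⟨h1, y, hy, h2, h3, h4⟩ := hO
    exact ⟨by rw [h1, h _ le_rfl], y, hy, h2, h3, ih _ _ l l' (fun i hi => h i (by omega)) h4⟩

theorem Ok.triv {I : Ideal A} {ι : Type} (d : ℕ) : ∀ (M : Type u) [AddCommGroup M] [Module A M]
    [Subsingleton M] (F : ι → I.Filtration M), Ok d M F (fun _ => 0) := by
  induction d with
  | zero =>
    intro M _ _ _ F
    exact ⟨Subsingleton.elim _ _, by simp⟩
  | succ d ih =>
    intro M _ _ _ F
    refine ⟨by simp, 0, zero_mem _, ?_, ?_, ?_⟩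
    · intro k
      exact Eventually.of_forall fun n => Subsingleton.elim _ _
    · intro u _
      exact Subsingleton.elim _ _
    · exact ih _ _

theorem quot_adic {I : Ideal A} {M : Type u} [AddCommGroup M] [Module A M] (p : Submodule A M) :
    (Ideal.stableFiltration I (⊤ : Submodule A M)).quot p = Ideal.stableFiltration I ⊤ := by
  ext n u
  simp [Ideal.Filtration.quot, Ideal.stableFiltration, Submodule.map_smul'']

variable [IsNoetherianRing A]

theorem lcZero_top_of_dim {M : Type u} [AddCommGroup M] [Module A M] [Module.Finite A M]
    (h : Module.supportDim A M ≤ 0) : lcZero (maximalIdeal A) M = ⊤ := by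
  rw [Module.supportDim_eq_ringKrullDim_quotient_annihilator] at h
  have h0 : Ring.KrullDimLE 0 (A ⧸ Module.annihilator A M) := by
    rw [Ring.krullDimLE_iff]; exact_mod_cast h
  have : IsArtinianRing (A ⧸ Module.annihilator A M) := isArtinianRing_iff_krullDimLE_zero.mpr h0
  obtain ⟨n, hn⟩ := IsLocalRing.exists_maximalIdeal_pow_le_of_isArtinianRing_quotient (Module.annihilator A M)
  rw [eq_top_iff]
  intro u _
  exact mem_lcZero.mpr ⟨n, fun a ha => Module.mem_annihilator.mp (hn ha) u⟩

open Pointwise in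
theorem dim_drop {M : Type u} [AddCommGroup M] [Module A M] [Module.Finite A M] {y : A}
    (hy : y ∈ maximalIdeal A) (hreg : ∀ u : M, y • u = 0 → u = 0) {d : ℕ}
    (h : Module.supportDim A M ≤ (d + 1 : ℕ)) :
    Module.supportDim A (M ⧸ (Ideal.span {y} • (⊤ : Submodule A M))) ≤ (d : ℕ) := by
  have hr : IsSMulRegular M y := by
    intro u v huv
    have : y • (u - v) = 0 := by rw [smul_sub]; exact sub_eq_zero.mpr huv
    exact sub_eq_zero.mp (hreg _ this)
  have h1 := Module.supportDim_quotSMulTop_succ_eq_supportDim hr hy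
  have h2 : Ideal.span {y} • (⊤ : Submodule A M) = y • ⊤ := Submodule.ideal_span_singleton_smul y ⊤
  rw [h2]
  change Module.supportDim A (QuotSMulTop y M) ≤ d
  rw [← h1] at h
  push_cast at h
  revert h
  generalize Module.supportDim A (QuotSMulTop y M) = x
  intro h
  induction x with
  | bot => exact bot_le
  | coe x =>
    have h3 : x + 1 ≤ (d : ℕ∞) + 1 := by exact_mod_cast h
    have h4 : x ≤ (d : ℕ∞) := (ENat.add_le_add_iff_right ENat.one_ne_top).mp h3
    exact_mod_cast h4

theorem chain_exists_y [Infinite (ResidueField A)] {I : Ideal A} (hI : IsMaxPrimary I) {ι : Type} [Finite ι] [Nonempty ι]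
    (d : ℕ) : ∀ (M : Type u) [AddCommGroup M] [Module A M] [Module.Finite A M]
    (_ : Module.supportDim A M ≤ (d : ℕ)) (F : ι → I.Filtration M) (_ : ∀ k, (F k).IsGood),
    ∃ l, Ok d M F l := by
  induction d with
  | zero =>
    intro M _ _ _ hd F hF
    have := ENat.natCast_toNat (lcZero_length (A := A) (N := M))
    exact ⟨fun _ => (Module.length A (lcZero (maximalIdeal A) M)).toNat,
      lcZero_top_of_dim (by exact_mod_cast hd), this.symm⟩
  | succ d ih =>
    intro M _ _ _ hd F hF
    have hlen := ENat.natCast_toNat (lcZero_length (A := A) (N := M))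
    have hF' : ∀ k, ((F k).quot (lcZero (maximalIdeal A) M)).IsGood := fun k => quot_good (hF k) _
    obtain ⟨y, hy, hfr⟩ := exists_fr (fun k => (F k).quot (lcZero (maximalIdeal A) M)) hF'
    have hreg : ∀ u : M ⧸ lcZero (maximalIdeal A) M, y • u = 0 → u = 0 := by
      obtain ⟨k⟩ := ‹Nonempty ι›
      exact fr_regular hI (hF' k) (lcZero_quot _) (hfr k)
    have hd' : Module.supportDim A (M ⧸ lcZero (maximalIdeal A) M) ≤ (d + 1 : ℕ) :=
      (Module.supportDim_le_of_surjective _ (Submodule.mkQ_surjective _)).trans hd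
    obtain ⟨l, hl⟩ := ih _ (dim_drop (IsMaxPrimary.le hI hy) hreg hd')
      (fun k => ((F k).quot (lcZero (maximalIdeal A) M)).quot _) (fun k => quot_good (hF' k) _)
    refine ⟨Function.update l (d + 1) (Module.length A (lcZero (maximalIdeal A) M)).toNat, ?_, y, hy, hfr, hreg, ?_⟩
    · simp [hlen]
    · refine Ok.congr d _ _ l _ (fun i hi => ?_) hl
      rw [Function.update_of_ne (by omega)]

theorem chain_exists_x {I : Ideal A} (hI : IsMaxPrimary I)
    (D : (N : Type u) → [AddCommGroup N] → [Module A N] → ℕ) (hD : IsExtendedDegree I D)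
    (d : ℕ) : ∀ (M : Type u) [AddCommGroup M] [Module A M] [Module.Finite A M]
    (_ : Module.supportDim A M ≤ (d : ℕ)),
    ∃ l : ℕ → ℕ, Ok d M (fun _ : Unit => Ideal.stableFiltration I (⊤ : Submodule A M)) l ∧
      (∑ j ∈ Finset.range (d + 1), l j ≤ D M) ∧ (Nontrivial M → 1 ≤ ∑ j ∈ Finset.range (d + 1), l j) := by
  have hsum : ∀ (M : Type u) [AddCommGroup M] [Module A M] [Module.Finite A M],
      D M = D (M ⧸ lcZero (maximalIdeal A) M) + (Module.length A (lcZero (maximalIdeal A) M)).toNat := by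
    intro M _ _ _
    have h := hD.h0_add M
    rw [moduleLength_eq] at h
    have hlen := ENat.natCast_toNat (lcZero_length (A := A) (N := M))
    rw [← hlen] at h
    exact_mod_cast h
  have hpos : ∀ (M : Type u) [AddCommGroup M] [Module A M] [Module.Finite A M], Nontrivial M →
      lcZero (maximalIdeal A) M = ⊤ → 1 ≤ (Module.length A (lcZero (maximalIdeal A) M)).toNat := by
    intro M _ _ _ _ ht
    have hlen := ENat.natCast_toNat (lcZero_length (A := A) (N := M))
    rw [Nat.one_le_iff_ne_zero]
    intro h0
    rw [h0] at hlen
    have h1 : Subsingleton (lcZero (maximalIdeal A) M) := Module.length_eq_zero_iff.mp (by simpa using hlen.symm)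
    rw [Submodule.subsingleton_iff_eq_bot, ht] at h1
    exact top_ne_bot h1
  induction d with
  | zero =>
    intro M _ _ _ hd
    have hlen := ENat.natCast_toNat (lcZero_length (A := A) (N := M))
    have ht : lcZero (maximalIdeal A) M = ⊤ := lcZero_top_of_dim (by exact_mod_cast hd)
    refine ⟨fun _ => (Module.length A (lcZero (maximalIdeal A) M)).toNat, ⟨ht, hlen.symm⟩, ?_, ?_⟩
    · simp only [zero_add, Finset.sum_range_one]
      have := hsum M
      omega
    · intro hn
      simpa using hpos M hn ht
  | succ d ih =>
    intro M _ _ _ hd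
    have hlen := ENat.natCast_toNat (lcZero_length (A := A) (N := M))
    have hs := hsum M
    rcases subsingleton_or_nontrivial (M ⧸ lcZero (maximalIdeal A) M) with hN | hN
    · have ht : lcZero (maximalIdeal A) M = ⊤ := Submodule.Quotient.subsingleton_iff.mp hN
      have hval : ∑ j ∈ Finset.range (d + 1 + 1), Function.update (fun _ => 0) (d + 1)
          (Module.length A (lcZero (maximalIdeal A) M)).toNat j = (Module.length A (lcZero (maximalIdeal A) M)).toNat := by
        rw [Finset.sum_range_succ, Finset.sum_eq_zero]
        · simp
        · intro i hi
          rw [Finset.mem_range] at hi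
          rw [Function.update_of_ne (by omega)]
      refine ⟨Function.update (fun _ => 0) (d + 1) (Module.length A (lcZero (maximalIdeal A) M)).toNat,
        ⟨by simp [hlen], 0, zero_mem _, ?_, ?_, ?_⟩, ?_, ?_⟩
      · intro k
        exact Eventually.of_forall fun n => Subsingleton.elim _ _
      · intro u _
        exact Subsingleton.elim _ _
      · refine Ok.congr d _ _ (fun _ => 0) _ (fun i hi => ?_) (Ok.triv d _ _)
        rw [Function.update_of_ne (by omega)]
      · rw [hval]; omega
      · intro hn
        rw [hval]
        exact hpos M hn ht
    · obtain ⟨x, hx, -, hfr, hDx⟩ := hD.generic _ hN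
      have hreg : ∀ u : M ⧸ lcZero (maximalIdeal A) M, x • u = 0 → u = 0 :=
        fr_regular hI (adic_good I) (lcZero_quot _) hfr
      have hd' : Module.supportDim A (M ⧸ lcZero (maximalIdeal A) M) ≤ (d + 1 : ℕ) :=
        (Module.supportDim_le_of_surjective _ (Submodule.mkQ_surjective _)).trans hd
      obtain ⟨l, hl, hl1, hl2⟩ := ih _ (dim_drop (IsMaxPrimary.le hI hx) hreg hd')
      have hval : ∑ j ∈ Finset.range (d + 1 + 1), Function.update l (d + 1)
          (Module.length A (lcZero (maximalIdeal A) M)).toNat j =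
          ∑ j ∈ Finset.range (d + 1), l j + (Module.length A (lcZero (maximalIdeal A) M)).toNat := by
        rw [Finset.sum_range_succ]
        congr 1
        · apply Finset.sum_congr rfl
          intro i hi
          rw [Finset.mem_range] at hi
          rw [Function.update_of_ne (by omega)]
        · simp
      refine ⟨Function.update l (d + 1) (Module.length A (lcZero (maximalIdeal A) M)).toNat,
        ⟨by simp [hlen], x, hx, ?_, hreg, ?_⟩, ?_, ?_⟩
      · intro _
        rw [quot_adic]; exact hfr
      · simp only [quot_adic]
        refine Ok.congr d _ _ l _ (fun i hi => ?_) hl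
        rw [Function.update_of_ne (by omega)]
      · rw [hval]; omega
      · intro _
        rw [hval]
        have hnt : Nontrivial ((M ⧸ lcZero (maximalIdeal A) M) ⧸
            (Ideal.span {x} • (⊤ : Submodule A (M ⧸ lcZero (maximalIdeal A) M)))) := by
          rw [Submodule.Quotient.nontrivial_iff]
          intro ht
          have hb : (⊤ : Submodule A (M ⧸ lcZero (maximalIdeal A) M)) = ⊥ := by
            apply Submodule.eq_bot_of_le_smul_of_le_jacobson_bot (Ideal.span {x}) _
              Module.Finite.fg_top ht.ge
            rw [Ideal.span_singleton_le_iff_mem]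
            exact maximalIdeal_le_jacobson _ (IsMaxPrimary.le hI hx)
          exact top_ne_bot hb
        have := hl2 hnt
        omega
end Chain
end FC

namespace FC
section Bound
variable {A : Type u} [CommRing A] [IsLocalRing A] [IsNoetherianRing A]

theorem reg_base {N : Type u} [AddCommGroup N] [Module A N] [Subsingleton N] (I : Ideal A)
    (F : ℕ → Submodule A N) (s : ℕ) : Reg I ⊥ F s where
  hJ := bot_le
  r1 := by
    intro n _ u j _
    rw [Subsingleton.elim u 0]; exact zero_mem _
  r3 := by
    intro n _
    exact (Subsingleton.elim _ _ : F (n + 1) = _).le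
  r4 := by
    intro n _ Q _ _ π X1 X0 _ _ _
    simp

theorem chain_bound {I : Ideal A} (hI : IsMaxPrimary I) {ι : Type} (s0 : ℕ)
    (d : ℕ) : ∀ (M : Type u) [AddCommGroup M] [Module A M] [Module.Finite A M]
    (F : ι → I.Filtration M) (l : ℕ → ℕ) (_ : Ok d M F l) (_ : ∀ k, (F k).IsGood)
    (k : ι) (_ : ∀ n, s0 + 1 ≤ n → (F k).N (n + 1) ≤ I • (F k).N n),
    ∃ (e : ℕ → ℤ) (J : Ideal A),
      Reg I J (fun n => ((F k).quot (lcZero (maximalIdeal A) M)).N n) (sq e s0 d) ∧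
      (∀ n, sq e s0 d ≤ n → PH d e n = l d + cl (((F k).quot (lcZero (maximalIdeal A) M)).N n)) ∧
      ∀ j, j ≤ d → 2 * |e j - (-1) ^ j * l j| ≤ Eb e s0 j := by
  induction d with
  | zero =>
    intro M _ _ _ F l hO hF k hgen
    have : Subsingleton (M ⧸ lcZero (maximalIdeal A) M) :=
      Submodule.Quotient.subsingleton_iff.mpr hO.1
    refine ⟨fun _ => l 0, ⊥, reg_base I _ _, ?_, ?_⟩
    · intro n _
      rw [PH_zero, (Subsingleton.elim _ _ : ((F k).quot (lcZero (maximalIdeal A) M)).N n = ⊤), cl_top, add_zero]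
    · intro j hj
      obtain rfl : j = 0 := by omega
      simp [Eb]
  | succ d ih =>
    intro M _ _ _ F l hO hF k hgen
    obtain ⟨hlen, y, hy, hfr, hreg, hO'⟩ := hO
    set L := lcZero (maximalIdeal A) M with hL
    have hG : ∀ k, ((F k).quot L).IsGood := fun k => quot_good (hF k) _
    have hG' : ∀ k, (((F k).quot L).quot (Ideal.span {y} • (⊤ : Submodule A (M ⧸ L)))).IsGood :=
      fun k => quot_good (hG k) _
    have hgen1 : ∀ n, s0 + 1 ≤ n → ((F k).quot L).N (n + 1) ≤ I • ((F k).quot L).N n := by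
      intro n hn
      simp only [Ideal.Filtration.quot]
      rw [← Submodule.map_smul'']
      exact Submodule.map_mono (hgen n hn)
    have hgen2 : ∀ n, s0 + 1 ≤ n → (((F k).quot L).quot (Ideal.span {y} • (⊤ : Submodule A (M ⧸ L)))).N (n + 1) ≤
        I • (((F k).quot L).quot (Ideal.span {y} • (⊤ : Submodule A (M ⧸ L)))).N n := by
      intro n hn
      change Submodule.map _ _ ≤ I • Submodule.map _ _
      rw [← Submodule.map_smul'']
      exact Submodule.map_mono (hgen1 n hn)
    obtain ⟨e, J', hR, hP, hE⟩ := ih _ _ l hO' hG' k hgen2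
    have hOl := hO'.length
    set Y := Ideal.span {y} • (⊤ : Submodule A (M ⧸ L)) with hYdef
    have hYmap : (⊤ : Submodule A (M ⧸ L)).map (LinearMap.lsmul A (M ⧸ L) y) = Y := by
      rw [hYdef]
      ext u
      rw [Submodule.ideal_span_singleton_smul, Submodule.mem_smul_pointwise_iff_exists, Submodule.mem_map]
      rfl
    set π : (M ⧸ L) →ₗ[A] (((M ⧸ L) ⧸ Y) ⧸ lcZero (maximalIdeal A) ((M ⧸ L) ⧸ Y)) :=
      (lcZero (maximalIdeal A) ((M ⧸ L) ⧸ Y)).mkQ ∘ₗ Y.mkQ with hπdef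
    have hker : LinearMap.ker π = (lcZero (maximalIdeal A) ((M ⧸ L) ⧸ Y)).comap Y.mkQ := by
      rw [hπdef, LinearMap.ker_comp, Submodule.ker_mkQ]
    obtain ⟨c1, hc1⟩ := fr_sup hI (hG k) (lcZero_quot _) (hfr k)
    obtain ⟨c2, hc2⟩ := lcZero_inf hI (hG' k)
    have main := one_step ((F k).quot L) (hG k).1 (good_fin hI (hG k)) hy hreg
      (c := max c1 c2) (fun n hn => hc1 n (le_trans (le_max_left _ _) hn))
      (s' := sq e s0 d) (fun n hn => hgen1 n (by have := le_sq e s0 d; omega))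
      π ((Submodule.mkQ_surjective _).comp (Submodule.mkQ_surjective _))
      (by
        intro u
        have : u ∈ (⊤ : Submodule A (M ⧸ L)) := trivial
        have h1 : y • u ∈ Y := by rw [← hYmap]; exact ⟨u, trivial, by simp⟩
        have h2 : Y.mkQ (y • u) = 0 := (Submodule.Quotient.mk_eq_zero Y).mpr h1
        rw [hπdef, LinearMap.comp_apply, h2, map_zero])
      (by
        intro n hn u hu
        rw [hYmap]
        have h1 : Y.mkQ u ∈ lcZero (maximalIdeal A) ((M ⧸ L) ⧸ Y) ⊓ (((F k).quot L).quot Y).N n := by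
          refine ⟨?_, ?_⟩
          · have := hu.1
            rw [hker] at this
            exact this
          · exact Submodule.mem_map_of_mem hu.2
        rw [hc2 n (le_trans (le_max_right _ _) hn), Submodule.mem_bot] at h1
        simpa using h1)
      (l := l d) (by
        rw [hYmap, hker, rl, Submodule.map_comap_eq_of_surjective (Submodule.mkQ_surjective _)]
        exact hOl)
      (fun n => ((((F k).quot L).quot Y).quot (lcZero (maximalIdeal A) ((M ⧸ L) ⧸ Y))).N n)
      (by
        intro n
        rw [hπdef, Submodule.map_comp]
        rfl)
      hR (fun n => PH d e (n + 1)) (fun n hn => hP (n + 1) hn)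
      (B := bb e (sq e s0 d) d) (fun j hj => PH_bound d e _ j hj)
    obtain ⟨hR2, E, hE1, hE2⟩ := main
    set e' := Function.update e (d + 1) ((-1) ^ (d + 1) * (E + l (d + 1))) with he'
    have hee : ∀ i, i ≤ d → e' i = e i := fun i hi => Function.update_of_ne (by omega) _ _
    have htop : e' (d + 1) = (-1) ^ (d + 1) * (E + l (d + 1)) := Function.update_self _ _ _
    have hsq : sq e' s0 (d + 1) = sq e s0 d + bb e (sq e s0 d) d := by
      rw [sq_congr s0 (d + 1) (fun i hi => hee i (by omega)), sq]
    have hsgn : ((-1 : ℤ) ^ (d + 1)) * (-1) ^ (d + 1) = 1 := by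
      rw [← mul_pow]; simp
    refine ⟨e', _, by rw [hsq]; exact hR2, ?_, ?_⟩
    · intro n hn
      rw [hsq] at hn
      rw [hE2 n hn, PH_sum, htop, ← mul_assoc, hsgn]
      have : ∑ j ∈ Finset.range n, PH d e' (j + 1) = ∑ j ∈ Finset.range n, PH d e (j + 1) :=
        Finset.sum_congr rfl fun j _ => PH_congr d hee _
      rw [this]
      ring
    · intro j hj
      rcases Nat.lt_or_ge d j with h | h
      · obtain rfl : j = d + 1 := by omega
        rw [htop, ← mul_sub, add_sub_cancel_right, abs_mul, abs_pow, abs_neg, abs_one, one_pow, one_mul,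
          Eb_congr s0 (d + 1) (fun i hi => hee i (by omega)), Eb]
        push_cast
        exact hE1
      · rw [hee j h, Eb_congr s0 j (fun i hi => hee i (by omega))]
        exact hE j h

/-- The Hilbert polynomial of the filtration itself. -/
theorem chain_poly {I : Ideal A} (hI : IsMaxPrimary I) {ι : Type} (s0 : ℕ)
    (d : ℕ) (M : Type u) [AddCommGroup M] [Module A M] [Module.Finite A M]
    (F : ι → I.Filtration M) (l : ℕ → ℕ) (hO : Ok d M F l) (hF : ∀ k, (F k).IsGood)
    (k : ι) (hgen : ∀ n, s0 + 1 ≤ n → (F k).N (n + 1) ≤ I • (F k).N n) :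
    ∃ e : ℕ → ℤ, (∀ᶠ n in atTop, cl ((F k).N n) = PH d e n) ∧
      ∀ j, j ≤ d → 2 * |e j - (-1) ^ j * l j| ≤ Eb e s0 j := by
  obtain ⟨e, J, -, hP, hE⟩ := chain_bound hI s0 d M F l hO hF k hgen
  refine ⟨e, ?_, hE⟩
  obtain ⟨c, hc⟩ := lcZero_inf hI (hF k)
  refine eventually_atTop.mpr ⟨max c (sq e s0 d), fun n hn => ?_⟩
  rw [hP n (le_trans (le_max_right _ _) hn), cl_eq_rl_add (good_fin hI (hF k) n) (lcZero (maximalIdeal A) M)]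
  have h1 : rl ((F k).N n) (lcZero (maximalIdeal A) M) = l d := by
    rw [rl_congr _ ⊥ _ (by rw [inf_comm, hc n (le_trans (le_max_left _ _) hn), bot_inf_eq]), ← hO.length]
    exact ((Submodule.equivMapOfInjective _ (by
      rw [← LinearMap.ker_eq_bot, Submodule.ker_mkQ]) _).length_eq).symm
  rw [h1]
  have h2 : cl (((F k).quot (lcZero (maximalIdeal A) M)).N n) = cl ((F k).N n ⊔ lcZero (maximalIdeal A) M) := by
    change cl (((F k).N n).map _) = _
    rw [cl_map _ (Submodule.mkQ_surjective _), Submodule.ker_mkQ]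
  rw [h2]
  simp
end Bound
end FC

namespace FC
section Num

/-- bounds for the coefficients -/
def gg (D r : ℕ) : ℕ → ℕ
  | 0 => D
  | 1 => 2 * (D + r) ^ 2 + 3 * (D + r) + 1
  | 2 => 4 * (D + r + 2) ^ 5
  | (j + 3) => (D + r + 2) ^ (3 * (j + 3).factorial - j)

/-- bounds for twice the errors -/
def EE (D r : ℕ) : ℕ → ℕ
  | 0 => 0
  | 1 => 4 * r * D + D * (D + 1)
  | 2 => 4 * (D + r) * ((D + r + 1) * (3 * (D + r) + 1)) +
      ((D + r + 1) * (3 * (D + r) + 1)) * ((D + r + 1) * (3 * (D + r) + 1) + 1)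
  | (j + 3) => (D + r + 2) ^ (3 * (j + 3).factorial - (j + 2))

theorem nat_le_of_int {a b : ℕ} (h : (0 : ℤ) ≤ (b : ℤ) - (a : ℤ)) : a ≤ b := by omega

theorem fact_ge (j : ℕ) : 2 * (j + 3) ≤ (j + 3).factorial := by
  induction j with
  | zero => decide
  | succ j ih =>
    rw [show j + 1 + 3 = (j + 3) + 1 by ring, Nat.factorial_succ]
    nlinarith

theorem EE_gg (D r : ℕ) (hD : 1 ≤ D) (j : ℕ) : 2 * D + 3 * EE D r j ≤ 2 * gg D r j := by
  match j with
  | 0 => simp [EE, gg]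
  | 1 =>
    simp only [EE, gg]
    zify
    nlinarith [sq_nonneg ((D : ℤ) - 2 * r), mul_nonneg (Nat.cast_nonneg (α := ℤ) D) (Nat.cast_nonneg (α := ℤ) r)]
  | 2 =>
    simp only [EE, gg]
    obtain ⟨w, hw⟩ : ∃ w, D + r = w + 1 := ⟨D + r - 1, by omega⟩
    have : D ≤ w + 1 := by omega
    rw [hw]
    calc _ ≤ 2 * (w + 1) + _ := by gcongr
      _ ≤ _ := by
        exact nat_le_of_int (by push_cast; ring_nf; positivity)
  | (j + 3) =>
    simp only [EE, gg]
    have hf := fact_ge j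
    rw [show 3 * (j + 3).factorial - j = (3 * (j + 3).factorial - (j + 2)) + 2 by omega, pow_add]
    set X := (D + r + 2) ^ (3 * (j + 3).factorial - (j + 2)) with hX
    have h1 : D + r + 2 ≤ X := Nat.le_self_pow (by omega) _
    have h2 : 3 ^ 2 ≤ (D + r + 2) ^ 2 := Nat.pow_le_pow_left (by omega) _
    have h3 := Nat.mul_le_mul_left X h2
    omega

theorem final_num (D r : ℕ) (hD : 1 ≤ D) (i : ℕ) (hi : 1 ≤ i) :
    gg D r i + EE D r (i + 1) ≤ 2 * (D + r + 2) ^ (3 * (i + 1).factorial - i) := by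
  match i, hi with
  | 1, _ =>
    simp only [EE, gg]
    obtain ⟨w, hw⟩ : ∃ w, D + r = w + 1 := ⟨D + r - 1, by omega⟩
    rw [hw]
    change _ ≤ 2 * (w + 1 + 2) ^ 5
    exact nat_le_of_int (by push_cast; ring_nf; positivity)
  | 2, _ =>
    simp only [EE, gg]
    norm_num [Nat.factorial]
    have h1 : 3 ≤ D + r + 2 := by omega
    generalize D + r + 2 = T at *
    have h2 : 4 ≤ T ^ 11 := by
      calc 4 ≤ 3 ^ 11 := by norm_num
        _ ≤ T ^ 11 := Nat.pow_le_pow_left h1 _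
    calc 4 * T ^ 5 + T ^ 16 ≤ T ^ 11 * T ^ 5 + T ^ 16 := by gcongr
      _ = 2 * T ^ 16 := by ring
  | (j + 3), _ =>
    change (D + r + 2) ^ (3 * (j + 3).factorial - j) + (D + r + 2) ^ (3 * (j + 1 + 3).factorial - (j + 1 + 2)) ≤
      2 * (D + r + 2) ^ (3 * (j + 1 + 3).factorial - (j + 3))
    have hf := fact_ge j
    have h0 : (j + 1 + 3).factorial = (j + 4) * (j + 3).factorial := by
      rw [show j + 1 + 3 = (j + 3) + 1 by ring, Nat.factorial_succ]
    have h1 : (D + r + 2) ^ (3 * (j + 3).factorial - j) ≤ (D + r + 2) ^ (3 * (j + 1 + 3).factorial - (j + 3)) := by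
      apply Nat.pow_le_pow_right (by omega)
      rw [h0]
      have : 3 * (j + 3).factorial + (j + 3) ≤ 3 * ((j + 4) * (j + 3).factorial) := by nlinarith
      omega
    rw [show j + 1 + 2 = j + 3 by ring]
    omega

theorem bb_le {e : ℕ → ℤ} {g : ℕ → ℕ} {s S j : ℕ} (h : ∀ i, i ≤ j → (e i).natAbs ≤ g i) (hs : s + 1 ≤ S) :
    bb e s j ≤ ∑ i ∈ Finset.range (j + 1), g i * S ^ (j - i) := by
  apply Finset.sum_le_sum
  intro i hi
  rw [Finset.mem_range] at hi
  exact Nat.mul_le_mul (h i (by omega)) (Nat.pow_le_pow_left hs _)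

theorem gg_le (D r : ℕ) (hD : 1 ≤ D) (i : ℕ) (hi : 1 ≤ i) :
    gg D r i ≤ (D + r + 2) ^ (3 * i.factorial + 3 - i) := by
  match i, hi with
  | 1, _ =>
    simp only [gg]
    generalize D + r = m
    change _ ≤ (m + 2) ^ 5
    exact nat_le_of_int (by push_cast; ring_nf; positivity)
  | 2, _ =>
    simp only [gg]
    norm_num [Nat.factorial]
    have h1 : 3 ≤ D + r + 2 := by omega
    generalize D + r + 2 = T at *
    calc 4 * T ^ 5 ≤ T ^ 2 * T ^ 5 := by gcongr; nlinarith
      _ = T ^ 7 := by ring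
  | (j + 3), _ =>
    simp only [gg]
    apply Nat.pow_le_pow_right (by omega)
    omega

theorem E_le {s B X : ℕ} (hs : s ≤ X) (hB : B ≤ X) (hX : 1 ≤ X) : 4 * s * B + B * (B + 1) ≤ 6 * X ^ 2 := by
  have h1 : s * B ≤ X * X := Nat.mul_le_mul hs hB
  have h2 : B * (B + 1) ≤ X * (X + X) := Nat.mul_le_mul hB (by omega)
  nlinarith

theorem small_num (D r : ℕ) (hD : 1 ≤ D) (e : ℕ → ℤ) :
    ((e 0).natAbs ≤ gg D r 0 → Eb e r 1 ≤ EE D r 1 ∧ sq e r 1 ≤ D + r) ∧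
    ((∀ i, i < 2 → (e i).natAbs ≤ gg D r i) → Eb e r 2 ≤ EE D r 2 ∧
      sq e r 2 + 1 ≤ 3 * (D + r + 2) ^ 2) ∧
    ((∀ i, i < 3 → (e i).natAbs ≤ gg D r i) → Eb e r 3 ≤ EE D r 3 ∧
      sq e r 3 + 1 ≤ (D + r + 2) ^ 8) := by
  have p1 : (e 0).natAbs ≤ gg D r 0 → Eb e r 1 ≤ EE D r 1 ∧ sq e r 1 ≤ D + r := by
    intro h
    simp only [gg] at h
    have hb : bb e r 0 = (e 0).natAbs := by simp [bb]
    simp only [Eb, sq, EE, hb]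
    refine ⟨?_, by omega⟩
    gcongr
  have p2 : (∀ i, i < 2 → (e i).natAbs ≤ gg D r i) → Eb e r 2 ≤ EE D r 2 ∧
      sq e r 2 + 1 ≤ 3 * (D + r + 2) ^ 2 := by
    intro h
    have hs := (p1 (h 0 (by omega))).2
    have hb := bb_le (e := e) (g := gg D r) (s := sq e r 1) (S := D + r + 1) (j := 1)
      (fun i hi => h i (by omega)) (by omega)
    have hb2 : bb e (sq e r 1) 1 ≤ (D + r + 1) * (3 * (D + r) + 1) := by
      refine hb.trans ?_
      simp [Finset.sum_range_succ, gg]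
      have : D ≤ D + r := by omega
      nlinarith [Nat.mul_le_mul this (le_refl (D + r + 1))]
    rw [show Eb e r 2 = 4 * sq e r 1 * bb e (sq e r 1) 1 + bb e (sq e r 1) 1 * (bb e (sq e r 1) 1 + 1) from rfl,
      show sq e r 2 = sq e r 1 + bb e (sq e r 1) 1 from rfl]
    simp only [EE]
    refine ⟨?_, ?_⟩
    · gcongr
    · nlinarith
  refine ⟨p1, p2, ?_⟩
  intro h
  have hs := (p2 (fun i hi => h i (by omega))).2
  have h1 : 3 ≤ D + r + 2 := by omega
  have hb := bb_le (e := e) (g := gg D r) (s := sq e r 2) (S := 3 * (D + r + 2) ^ 2) (j := 2)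
      (fun i hi => h i (by omega)) hs
  have hb2 : bb e (sq e r 2) 2 ≤ 15 * (D + r + 2) ^ 5 := by
    refine hb.trans ?_
    simp [Finset.sum_range_succ, gg]
    have hg1 : 2 * (D + r) ^ 2 + 3 * (D + r) + 1 ≤ 2 * (D + r + 2) ^ 2 := by nlinarith
    have hD' : D ≤ D + r + 2 := by omega
    generalize D + r + 2 = T at *
    calc _ ≤ T * (3 * T ^ 2) ^ 2 + 2 * T ^ 2 * (3 * T ^ 2) + 4 * T ^ 5 := by gcongr
      _ = 13 * T ^ 5 + 2 * 3 * T ^ 4 := by ring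
      _ ≤ 13 * T ^ 5 + 2 * T * T ^ 4 := by gcongr
      _ = 15 * T ^ 5 := by ring
  rw [show Eb e r 3 = 4 * sq e r 2 * bb e (sq e r 2) 2 + bb e (sq e r 2) 2 * (bb e (sq e r 2) 2 + 1) from rfl,
    show sq e r 3 = sq e r 2 + bb e (sq e r 2) 2 from rfl]
  simp only [EE]
  norm_num [Nat.factorial]
  generalize D + r + 2 = T at *
  have hs2 : sq e r 2 ≤ T ^ 5 := by
    have : 3 * T ^ 2 ≤ T ^ 3 * T ^ 2 := by gcongr; nlinarith [Nat.pow_le_pow_left h1 3]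
    calc _ ≤ 3 * T ^ 2 := by omega
      _ ≤ _ := this
      _ = T ^ 5 := by ring
  have hT5 : 1 ≤ T ^ 5 := Nat.one_le_pow _ _ (by omega)
  refine ⟨?_, ?_⟩
  · calc _ ≤ 4 * T ^ 5 * (15 * T ^ 5) + (15 * T ^ 5) * (15 * T ^ 5 + T ^ 5) := by gcongr
      _ = 300 * T ^ 10 := by ring
      _ ≤ T ^ 6 * T ^ 10 := by
          gcongr
          calc 300 ≤ 3 ^ 6 := by norm_num
            _ ≤ T ^ 6 := Nat.pow_le_pow_left h1 _
      _ = T ^ 16 := by ring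
  · calc _ ≤ T ^ 5 + 15 * T ^ 5 + T ^ 5 := by omega
      _ = 17 * T ^ 5 := by ring
      _ ≤ T ^ 3 * T ^ 5 := by
          gcongr
          calc 17 ≤ 3 ^ 3 := by norm_num
            _ ≤ T ^ 3 := Nat.pow_le_pow_left h1 _
      _ = T ^ 8 := by ring

theorem sq_pow (k : ℕ) : 6 * (k + 4) ^ 2 ≤ 3 ^ (k + 5) := by
  induction k with
  | zero => norm_num
  | succ k ih => rw [show k + 1 + 5 = (k + 5) + 1 by ring, pow_succ 3 (k + 5)]; generalize 3 ^ (k + 5) = z at *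
                 have : 6 * (k + 1 + 4) ^ 2 + (12 * k ^ 2 + 84 * k + 138) = 3 * (6 * (k + 4) ^ 2) := by ring
                 omega

theorem lin_pow (k : ℕ) : k + 6 ≤ 3 ^ (k + 2) := by
  induction k with
  | zero => norm_num
  | succ k ih => rw [show k + 1 + 2 = (k + 2) + 1 by ring, pow_succ]; omega

theorem big_num (D r : ℕ) (hD : 1 ≤ D) (e : ℕ → ℤ) (k : ℕ) :
    (∀ i, i < k + 3 → (e i).natAbs ≤ gg D r i) → Eb e r (k + 3) ≤ EE D r (k + 3) ∧
      sq e r (k + 3) + 1 ≤ (D + r + 2) ^ ((k + 3).factorial + (k + 2).factorial) := by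
  induction k with
  | zero =>
    intro h
    exact (small_num D r hD e).2.2 h
  | succ k ih =>
    intro h
    have hs := (ih (fun i hi => h i (by omega))).2
    have hb := bb_le (e := e) (g := gg D r) (s := sq e r (k + 3)) (j := k + 3)
      (fun i hi => h i (by omega)) hs
    have hfa : (k + 3).factorial = (k + 3) * (k + 2).factorial := Nat.factorial_succ _
    have hfb : (k + 4).factorial = (k + 4) * (k + 3).factorial := Nat.factorial_succ _
    have hge := fact_ge k
    have hge2 := fact_ge (k + 1)
    rw [show k + 1 + 3 = k + 4 by ring] at hge2
    have hb1 : 2 ≤ (k + 2).factorial := by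
      calc 2 = Nat.factorial 2 := rfl
        _ ≤ _ := Nat.factorial_le (by omega)
    have hT : 3 ≤ D + r + 2 := by omega
    have hb2 : bb e (sq e r (k + 3)) (k + 3) ≤ (k + 4) * (D + r + 2) ^ ((k + 4).factorial + 1) := by
      refine hb.trans ?_
      calc _ ≤ ∑ i ∈ Finset.range (k + 3 + 1), (D + r + 2) ^ ((k + 4).factorial + 1) := by
            apply Finset.sum_le_sum
            intro i hi
            rw [Finset.mem_range] at hi
            rw [← pow_mul]
            obtain ⟨w, hw⟩ : ∃ w, k + 3 = i + w := ⟨k + 3 - i, by omega⟩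
            rw [show k + 3 - i = w by omega]
            have hexp : (k + 4).factorial = i * ((k + 3).factorial + (k + 2).factorial) +
                ((k + 3).factorial + (k + 2).factorial) * w := by
              have : (k + 4).factorial = (k + 3) * ((k + 3).factorial + (k + 2).factorial) := by
                rw [hfb]; nlinarith
              rw [this, hw]; ring
            rcases Nat.eq_zero_or_pos i with h0 | h0
            · subst h0
              calc _ ≤ (D + r + 2) * (D + r + 2) ^ (((k + 3).factorial + (k + 2).factorial) * w) := by
                    gcongr
                    simp only [gg]; omega
                _ = _ := by rw [hexp, zero_mul, zero_add, pow_succ']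
            · calc _ ≤ (D + r + 2) ^ (3 * i.factorial + 3 - i) *
                      (D + r + 2) ^ (((k + 3).factorial + (k + 2).factorial) * w) := by
                    gcongr
                    exact gg_le D r hD i h0
                _ = (D + r + 2) ^ ((3 * i.factorial + 3 - i) + ((k + 3).factorial + (k + 2).factorial) * w) := by
                    rw [pow_add]
                _ ≤ _ := by
                    apply Nat.pow_le_pow_right (by omega)
                    rw [hexp]
                    have hi1 : i.factorial ≤ i * (k + 2).factorial := by
                      obtain ⟨v, rfl⟩ : ∃ v, i = v + 1 := ⟨i - 1, by omega⟩
                      rw [Nat.factorial_succ]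
                      exact Nat.mul_le_mul_left _ (Nat.factorial_le (by omega))
                    have ha : 3 * (k + 2).factorial ≤ (k + 3).factorial := by
                      rw [hfa]; exact Nat.mul_le_mul_right _ (by omega)
                    have : i * (4 * (k + 2).factorial) ≤ i * ((k + 3).factorial + (k + 2).factorial) :=
                      Nat.mul_le_mul_left _ (by omega)
                    have : i * 2 ≤ i * (k + 2).factorial := Nat.mul_le_mul_left _ hb1
                    have : i * (4 * (k + 2).factorial) = 4 * (i * (k + 2).factorial) := by ring
                    omega
        _ = _ := by simp
    set X := (k + 4) * (D + r + 2) ^ ((k + 4).factorial + 1) with hX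
    have hX1 : 1 ≤ X := by
      rw [hX]
      exact Nat.mul_pos (by omega) (Nat.pow_pos (by omega))
    have hsX : sq e r (k + 3) + 1 ≤ (D + r + 2) ^ ((k + 4).factorial + 1) := by
      refine hs.trans (Nat.pow_le_pow_right (by omega) ?_)
      have := Nat.factorial_le (show k + 2 ≤ k + 3 by omega)
      rw [hfb]
      nlinarith
    have hPX : (D + r + 2) ^ ((k + 4).factorial + 1) ≤ X := by
      rw [hX]; exact Nat.le_mul_of_pos_left _ (by omega)
    rw [show Eb e r (k + 1 + 3) = 4 * sq e r (k + 3) * bb e (sq e r (k + 3)) (k + 3) +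
        bb e (sq e r (k + 3)) (k + 3) * (bb e (sq e r (k + 3)) (k + 3) + 1) from rfl,
      show sq e r (k + 1 + 3) = sq e r (k + 3) + bb e (sq e r (k + 3)) (k + 3) from rfl]
    refine ⟨?_, ?_⟩
    · refine (E_le (by omega) hb2 hX1).trans ?_
      simp only [EE]
      rw [show k + 1 + 3 = k + 4 by ring, show k + 1 + 2 = k + 3 by ring, hX, mul_pow, ← pow_mul, ← mul_assoc]
      calc _ ≤ 3 ^ (k + 5) * (D + r + 2) ^ (((k + 4).factorial + 1) * 2) := by
            gcongr
            exact sq_pow k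
        _ ≤ (D + r + 2) ^ (k + 5) * (D + r + 2) ^ (((k + 4).factorial + 1) * 2) :=
            Nat.mul_le_mul_right _ (Nat.pow_le_pow_left hT _)
        _ = (D + r + 2) ^ (k + 5 + ((k + 4).factorial + 1) * 2) := (pow_add _ _ _).symm
        _ ≤ _ := by
            apply Nat.pow_le_pow_right (by omega)
            have : 3 * (k + 3) + 10 ≤ (k + 4).factorial := by
              rw [hfb]; nlinarith
            omega
    · have h5 : (k + 1 + 2).factorial = (k + 3).factorial := rfl
      rw [h5, show k + 1 + 3 = k + 4 by ring]
      calc _ ≤ (D + r + 2) ^ ((k + 4).factorial + 1) + X := by omega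
        _ = (k + 5) * (D + r + 2) ^ ((k + 4).factorial + 1) := by rw [hX]; ring
        _ ≤ 3 ^ (k + 2) * (D + r + 2) ^ ((k + 4).factorial + 1) := by
            gcongr
            have := lin_pow k
            omega
        _ ≤ (D + r + 2) ^ (k + 2) * (D + r + 2) ^ ((k + 4).factorial + 1) :=
            Nat.mul_le_mul_right _ (Nat.pow_le_pow_left hT _)
        _ = (D + r + 2) ^ (k + 2 + ((k + 4).factorial + 1)) := (pow_add _ _ _).symm
        _ ≤ _ := by
            apply Nat.pow_le_pow_right (by omega)
            omega

theorem Eb_le (D r : ℕ) (hD : 1 ≤ D) (e : ℕ → ℤ) (j : ℕ)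
    (h : ∀ i, i < j → (e i).natAbs ≤ gg D r i) : Eb e r j ≤ EE D r j := by
  match j with
  | 0 => simp [Eb]
  | 1 => exact ((small_num D r hD e).1 (h 0 (by omega))).1
  | 2 => exact ((small_num D r hD e).2.1 h).1
  | (k + 3) => exact (big_num D r hD e k h).1

/-- coefficient bounds -/
theorem coeff_bounds (D r d : ℕ) (hD : 1 ≤ D) (lx l : ℕ → ℕ) (hlx : ∀ j, j ≤ d → lx j ≤ D) (eX e : ℕ → ℤ)
    (h1 : ∀ j, j ≤ d → 2 * |eX j - (-1) ^ j * lx j| ≤ Eb eX r j)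
    (h2 : ∀ j, j ≤ d → 2 * |eX j - (-1) ^ j * l j| ≤ Eb eX r j)
    (h3 : ∀ j, j ≤ d → 2 * |e j - (-1) ^ j * l j| ≤ Eb e r j) :
    ∀ j, j ≤ d → (eX j).natAbs ≤ gg D r j ∧ (e j).natAbs ≤ gg D r j := by
  intro j
  induction j using Nat.strong_induction_on with
  | _ j ih =>
    intro hj
    have b1 := Eb_le D r hD eX j (fun i hi => (ih i hi (by omega)).1)
    have b2 := Eb_le D r hD e j (fun i hi => (ih i hi (by omega)).2)
    have b3 := EE_gg D r hD j
    have a1 := h1 j hj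
    have a2 := h2 j hj
    have a3 := h3 j hj
    have a4 := hlx j hj
    rcases neg_one_pow_eq_or ℤ j with hs | hs <;> rw [hs] at a1 a2 a3 <;> simp only [one_mul, neg_mul] at a1 a2 a3 <;>
      rw [← Int.natCast_natAbs] at a1 a2 a3 <;> omega

theorem final_bounds (D r d : ℕ) (hD : 1 ≤ D) (l : ℕ → ℕ) (e e' : ℕ → ℤ)
    (he : ∀ j, j ≤ d → (e j).natAbs ≤ gg D r j) (he' : ∀ j, j ≤ d → (e' j).natAbs ≤ gg D r j)
    (h3 : ∀ j, j ≤ d → 2 * |e j - (-1) ^ j * l j| ≤ Eb e r j)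
    (h4 : ∀ j, j ≤ d → 2 * |e' j - (-1) ^ j * l j| ≤ Eb e' r j) (i : ℕ) (hi : 1 ≤ i) (hid : i + 1 ≤ d) :
    |e i + e (i + 1) - e' (i + 1)| ≤ 2 * ((D : ℤ) + r + 2) ^ (3 * (i + 1).factorial - i) := by
  have b1 := Eb_le D r hD e (i + 1) (fun k hk => he k (by omega))
  have b2 := Eb_le D r hD e' (i + 1) (fun k hk => he' k (by omega))
  have b3 := final_num D r hD i hi
  have a0 := he i (by omega)
  have a1 := h3 (i + 1) hid
  have a2 := h4 (i + 1) hid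
  have b4 : ((gg D r i + EE D r (i + 1) : ℕ) : ℤ) ≤ 2 * ((D : ℤ) + r + 2) ^ (3 * (i + 1).factorial - i) := by
    exact_mod_cast b3
  refine le_trans ?_ b4
  push_cast
  rcases neg_one_pow_eq_or ℤ (i + 1) with hs | hs <;> rw [hs] at a1 a2 <;>
    simp only [one_mul, neg_mul] at a1 a2 <;> rw [← Int.natCast_natAbs] at a1 a2 ⊢ <;> omega
end Num
end FC

namespace FC
section Main
variable {A : Type u} [CommRing A] {M : Type u} [AddCommGroup M] [Module A M]

/-- the filtration `M ⊇ q M_0 ⊇ q M_1 ⊇ ...` -/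
def qfil {I : Ideal A} (F : I.Filtration M) (q : Ideal A) (h0 : F.N 0 = ⊤) (hIq : I ≤ q) : I.Filtration M where
  N n := match n with
    | 0 => ⊤
    | n + 1 => q • F.N n
  mono n := by
    match n with
    | 0 => exact le_top
    | n + 1 => exact Submodule.smul_mono le_rfl (F.mono n)
  smul_le n := by
    match n with
    | 0 => change I • ⊤ ≤ q • F.N 0; rw [h0]; exact Submodule.smul_mono_left hIq
    | n + 1 =>
      change I • (q • F.N n) ≤ q • F.N (n + 1)
      rw [← Submodule.mul_smul, mul_comm, Submodule.mul_smul]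
      exact Submodule.smul_mono le_rfl (F.smul_le n)

theorem qfil_gen {I : Ideal A} (F : I.Filtration M) (q : Ideal A) (h0 : F.N 0 = ⊤) (hIq : I ≤ q) (r : ℕ)
    (hr : ∀ n, r ≤ n → F.N (n + 1) = I • F.N n) (n : ℕ) (hn : r + 1 ≤ n) :
    (qfil F q h0 hIq).N (n + 1) = I • (qfil F q h0 hIq).N n := by
  obtain ⟨m, rfl⟩ : ∃ m, n = m + 1 := ⟨n - 1, by omega⟩
  change q • F.N (m + 1) = I • (q • F.N m)
  rw [hr m (by omega), ← Submodule.mul_smul, ← Submodule.mul_smul, mul_comm]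

theorem genDeg_spec {I : Ideal A} (F : I.Filtration M) (hF : F.Stable) :
    ∀ n, F.genDeg ≤ n → F.N (n + 1) = I • F.N n := by
  have : F.genDeg ∈ {t | ∀ n, t ≤ n → F.N (n + 1) = I • F.N n} := by
    apply Nat.sInf_mem
    obtain ⟨n0, h⟩ := hF
    exact ⟨n0, fun n hn => (h n hn).symm⟩
  exact this

theorem qlen {X Z : Submodule A M} (h : X ≤ Z) (hX : FinCl X) (H : ℕ)
    (hH : moduleLength A (Z ⧸ X.comap Z.subtype) = (H : WithBot ℕ∞)) : (H : ℤ) = cl X - cl Z := by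
  have h1 := cl_eq_rl_add hX Z
  rw [sup_eq_right.mpr h] at h1
  have h2 : rl X Z = Module.length A (Z ⧸ X.comap Z.subtype) := by
    have h3 := length_map_congr (⊤ : Submodule A Z) (X.mkQ ∘ₗ Z.subtype) (X.comap Z.subtype).mkQ
      (by intro z _; simp)
    rw [Submodule.map_comp, Submodule.map_top, Submodule.range_subtype, Submodule.map_top,
      Submodule.range_mkQ, Module.length_top] at h3
    exact h3
  rw [moduleLength_eq, ← h2] at hH
  have h4 : rl X Z = (H : ℕ∞) := by exact_mod_cast hH
  rw [h4] at h1
  simp at h1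
  omega

theorem eventually_shift {p : ℕ → Prop} (h : ∀ᶠ n in atTop, p (n + 1)) : ∀ᶠ n in atTop, p n := by
  obtain ⟨a, ha⟩ := eventually_atTop.mp h
  refine eventually_atTop.mpr ⟨a + 1, fun n hn => ?_⟩
  obtain ⟨m, rfl⟩ : ∃ m, n = m + 1 := ⟨n - 1, by omega⟩
  exact ha m (by omega)

theorem shift_eventually {p : ℕ → Prop} (h : ∀ᶠ n in atTop, p n) : ∀ᶠ n in atTop, p (n + 1) :=
  (tendsto_add_atTop_nat 1).eventually h

end Main
end FC

/-- **Proposition 3.2.** Under the assumptions of Lemma 3.1 (good `I`-filtration `𝓜`,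
extended degree `D`, `I ⊆ q`, `M_{n+1} ⊆ q•M_n`), for the Hilbert coefficients
`eF i = e_i(F_q(𝓜))` of the fiber cone `F_q(𝓜) = ⊕ M_n/q•M_n` (defined by
`ℓ(M_n/q•M_n) = ∑_{i=0}^{d-1} (-1)^i e_i C(n+d-1-i, d-1-i)` for `n ≫ 0`):
(i)  `e_0(F_q(𝓜)) ≤ 2·D(I,M)·(D(I,M) + r(𝓜))`;
(ii) `|e_i(F_q(𝓜))| ≤ 2·(D(I,M) + r(𝓜) + 2)^(3(i+1)! - i)` for `1 ≤ i ≤ d-1`. -/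
theorem fiberCone_hilbert_coefficients_bounds
    {A : Type u} [CommRing A] [IsLocalRing A] [IsNoetherianRing A]
    [Infinite (ResidueField A)]
    {M : Type u} [AddCommGroup M] [Module A M] [Module.Finite A M]
    (I : Ideal A) (hI : IsMaxPrimary I)
    (F : I.Filtration M) (hF : F.IsGood)
    (d : ℕ) (hd : 1 ≤ d)
    (hdim : ringKrullDim (A ⧸ Module.annihilator A M) = (d : WithBot ℕ∞))
    (D : (N : Type u) → [AddCommGroup N] → [Module A N] → ℕ)
    (hD : IsExtendedDegree I D)
    (q : Ideal A) (hIq : I ≤ q)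
    (hqF : ∀ n : ℕ, F.N (n + 1) ≤ q • F.N n)
    -- the Hilbert function of the fiber cone: `HFq n = ℓ(M_n/q•M_n)`
    (HFq : ℕ → ℕ)
    (hHFq : ∀ n : ℕ,
      moduleLength A (F.N n ⧸ (q • F.N n).comap (F.N n).subtype) = (HFq n : WithBot ℕ∞))
    -- the Hilbert coefficients of the fiber cone
    (eF : ℕ → ℤ)
    (heF : ∀ᶠ n : ℕ in atTop, (HFq n : ℤ) =
      ∑ i ∈ Finset.range d, (-1) ^ i * eF i * ((n + d - 1 - i).choose (d - 1 - i) : ℤ)) :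
    (eF 0 ≤ 2 * (D M : ℤ) * ((D M : ℤ) + (F.genDeg : ℤ))) ∧
    (∀ i : ℕ, 1 ≤ i → i ≤ d - 1 →
      |eF i| ≤ 2 * ((D M : ℤ) + (F.genDeg : ℤ) + 2) ^ (3 * (i + 1).factorial - i)) := by
  have hsd : Module.supportDim A M ≤ (d : ℕ) := by
    rw [Module.supportDim_eq_ringKrullDim_quotient_annihilator, hdim]
  have hnt : Nontrivial M := by
    by_contra hn
    rw [not_nontrivial_iff_subsingleton] at hn
    have h1 : Module.annihilator A M = ⊤ := Module.annihilator_eq_top_iff.mpr hn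
    have h2 : Subsingleton (A ⧸ Module.annihilator A M) := by
      rw [h1]; infer_instance
    rw [ringKrullDim_eq_bot_of_subsingleton] at hdim
    exact absurd hdim (by simp)
  have hr := FC.genDeg_spec F hF.2
  generalize F.genDeg = r at *
  -- the auxiliary filtration
  set F' := FC.qfil F q hF.1 hIq with hF'
  have hF'g := FC.qfil_gen F q hF.1 hIq r hr
  rw [← hF'] at hF'g
  have hgood' : F'.IsGood := ⟨rfl, r + 1, fun n hn => (hF'g n hn).symm⟩
  let G : Fin 3 → I.Filtration M := ![Ideal.stableFiltration I (⊤ : Submodule A M), F, F']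
  have hG : ∀ k, (G k).IsGood := by
    intro k
    fin_cases k
    · exact FC.adic_good I
    · exact hF
    · exact hgood'
  have hadic : ∀ n, r + 1 ≤ n → (Ideal.stableFiltration I (⊤ : Submodule A M)).N (n + 1) ≤
      I • (Ideal.stableFiltration I (⊤ : Submodule A M)).N n := by
    intro n _
    simp [Ideal.stableFiltration, pow_succ', Submodule.mul_smul]
  obtain ⟨l, hl⟩ := FC.chain_exists_y hI d M hsd G hG
  obtain ⟨lx, hlx, hlxD, hlx1⟩ := FC.chain_exists_x hI D hD d M hsd
  have hD1 : 1 ≤ D M := (hlx1 hnt).trans hlxD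
  have hlxj : ∀ j, j ≤ d → lx j ≤ D M := by
    intro j hj
    exact (Finset.single_le_sum (f := lx) (fun _ _ => Nat.zero_le _) (Finset.mem_range.mpr (by omega))).trans hlxD
  obtain ⟨eX, hX1, hX2⟩ := FC.chain_poly hI r d M _ lx hlx (fun _ => FC.adic_good I) () hadic
  obtain ⟨eI, hI1, hI2⟩ := FC.chain_poly hI r d M G l hl hG 0 hadic
  obtain ⟨e, he1, he2⟩ := FC.chain_poly hI r d M G l hl hG 1 (fun n hn => (hr n (by omega)).le)
  obtain ⟨e', he1', he2'⟩ := FC.chain_poly hI r d M G l hl hG 2 (fun n hn => (hF'g n hn).le)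
  have hXI : ∀ i, i ≤ d → eX i = eI i := by
    apply FC.PH_uniq
    filter_upwards [hX1, hI1] with n h1 h2
    rw [← h1, ← h2]; rfl
  have hI2' : ∀ j, j ≤ d → 2 * |eX j - (-1) ^ j * l j| ≤ FC.Eb eX r j := by
    intro j hj
    rw [hXI j hj, FC.Eb_congr (e' := eI) r j (fun i hi => hXI i (by omega))]
    exact hI2 j hj
  have hb := FC.coeff_bounds (D M) r d hD1 lx l hlxj eX e hX2 hI2' he2
  have hb' := FC.coeff_bounds (D M) r d hD1 lx l hlxj eX e' hX2 hI2' he2'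
  have z : ∀ (u : ℕ → ℤ) (l : ℕ → ℕ), (∀ j, j ≤ d → 2 * |u j - (-1) ^ j * l j| ≤ FC.Eb u r j) → u 0 = l 0 := by
    intro u l h
    have := h 0 (by omega)
    simp only [FC.Eb, pow_zero, one_mul, Nat.cast_zero] at this
    have h2 : |u 0 - l 0| = 0 := le_antisymm (by omega) (abs_nonneg _)
    rw [abs_eq_zero] at h2
    omega
  have z0 := z e l he2
  have z0' := z e' l he2'
  have zX := z eX lx hX2
  have zI := z eX l hI2'
  have hlx0 := hlxj 0 (by omega)
  obtain ⟨c, rfl⟩ : ∃ c, d = c + 1 := ⟨d - 1, by omega⟩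
  -- Hilbert function of the fiber cone
  have hH : ∀ n, (HFq n : ℤ) = FC.cl (F'.N (n + 1)) - FC.cl (F.N n) := by
    intro n
    exact FC.qlen (X := F'.N (n + 1)) (Submodule.smul_le_right) (FC.good_fin hI hgood' _) _ (hHFq n)
  have heP : ∀ᶠ n in atTop, (HFq n : ℤ) = FC.PH c eF (n + 1) := by
    filter_upwards [heF] with n hn
    rw [hn, FC.PH]
    apply Finset.sum_congr rfl
    intro i hi
    rw [Finset.mem_range] at hi
    rw [Nat.multichoose_eq]
    congr 3 <;> omega
  have heq : ∀ i, i ≤ c → eF i = e i + e (i + 1) - e' (i + 1) := by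
    apply FC.PH_uniq c eF (fun i => e i + e (i + 1) - e' (i + 1))
    apply FC.eventually_shift
    filter_upwards [heP, he1, FC.shift_eventually he1'] with n h1 h2 h3
    have h4 := hH n
    change FC.cl (F.N n) = _ at h2
    change FC.cl (F'.N (n + 1)) = _ at h3
    have h5 := FC.PH_succ c e n
    have h6 := FC.PH_shift c (fun i => e' i - e i) (by simp [z0, z0']) (n + 1)
    rw [FC.PH_sub] at h6
    have h7 := FC.PH_sub c (fun i => e' (i + 1)) (fun i => e (i + 1)) (n + 1)
    have h8 := FC.PH_sub c (fun i => e i + e (i + 1)) (fun i => e' (i + 1)) (n + 1)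
    have h9 := FC.PH_add c e (fun i => e (i + 1)) (n + 1)
    rw [h8, h9]
    rw [h7] at h6
    linarith
  constructor
  · have hle : eF 0 ≤ e 0 := by
      by_contra hlt
      push Not at hlt
      have hp := FC.shift_eventually (FC.PH_pos c (fun i => eF i - e i) (by omega))
      obtain ⟨n, h1, h2, h3, h4⟩ := (hp.and (heP.and (he1.and (FC.shift_eventually he1)))).exists
      change FC.cl (F.N n) = _ at h3
      change FC.cl (F.N (n + 1)) = _ at h4
      have h5 := FC.PH_succ c e n
      have h6 := hH n
      have h7 : FC.cl (F'.N (n + 1)) ≤ FC.cl (F.N (n + 1)) := FC.cl_anti (FC.good_fin hI hF _) (hqF n)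
      rw [FC.PH_sub] at h1
      linarith
    have h1 : eF 0 ≤ (D M : ℤ) := by omega
    have h2 : (1 : ℤ) ≤ D M := by exact_mod_cast hD1
    have h3 : (0 : ℤ) ≤ r := by positivity
    nlinarith [mul_nonneg (show (0 : ℤ) ≤ D M by positivity) h3]
  · intro i hi hic
    rw [heq i (by omega)]
    exact FC.final_bounds (D M) r (c + 1) hD1 l e e' (fun j hj => (hb j hj).2) (fun j hj => (hb' j hj).2)
      he2 he2' i hi (by omega)
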